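/- arXiv:2201.08521 — 3 statements merged into one kernel-verified Lean document; each statement's English description precedes it below -/
import Mathlib

section
/- In PG(n,q), with n ≥ 5, let d satisfy 2 ≤ d ≤ q−1 and gcd(d−1, q) = 1. Every plane blocking set K of type (a,b,c)_{n-1} with a = θ_{n-3}, b = q^{n−3}(qd+d−q) + θ_{n-4} and c = q^{n−2}d + θ_{n-3} is a maximal arc cone: there exist an (n−3)-dimensional subspace V ⊆ K and a plane τ disjoint from V such that K ∩ τ is a maximal arc of degree d in τ and K is the union of V together with all points on lines joining a point of V to a point of K ∩ τ. -/
open Module Set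

noncomputable section

variable (F : Type) [Field F]

/-- The point set of `PG(n,q)`: the projectivization of `GF(q)^{n+1}`. -/
abbrev PGPoint (n : ℕ) := Projectivization F (Fin (n + 1) → F)

/-- The set of points of the projective space lying in (the projectivization of)
a linear subspace `W`. A `d`-dimensional projective subspace corresponds to a
submodule `W` with `finrank F W = d + 1`; hyperplanes correspond to `finrank F W = n`. -/
def projSet (n : ℕ) (W : Submodule F (Fin (n + 1) → F)) : Set (PGPoint F n) :=
  {x | x.submodule ≤ W}

/-- `θ_m = (q^{m+1} - 1)/(q - 1)`, the number of points of `PG(m,q)`. -/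
def theta (q m : ℕ) : ℕ := (q ^ (m + 1) - 1) / (q - 1)

/-- `K` is of type `(a,b,c)_{n-1}`: every hyperplane meets `K` in `a`, `b` or `c`
points, and each of the three values is attained by some hyperplane. -/
def IsType3 (n : ℕ) (K : Set (PGPoint F n)) (a b c : ℕ) : Prop :=
  (∀ W : Submodule F (Fin (n + 1) → F), finrank F W = n →
      (K ∩ projSet F n W).ncard = a ∨ (K ∩ projSet F n W).ncard = b ∨
        (K ∩ projSet F n W).ncard = c) ∧
  (∃ W : Submodule F (Fin (n + 1) → F), finrank F W = n ∧ (K ∩ projSet F n W).ncard = a) ∧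
  (∃ W : Submodule F (Fin (n + 1) → F), finrank F W = n ∧ (K ∩ projSet F n W).ncard = b) ∧
  (∃ W : Submodule F (Fin (n + 1) → F), finrank F W = n ∧ (K ∩ projSet F n W).ncard = c)

/-- `tnum K m`: the number of hyperplanes meeting `K` in exactly `m` points. -/
def tnum (n : ℕ) (K : Set (PGPoint F n)) (m : ℕ) : ℕ :=
  {W : Submodule F (Fin (n + 1) → F) | finrank F W = n ∧ (K ∩ projSet F n W).ncard = m}.ncard

/-- `K` blocks every `t`-dimensional projective subspace of `PG(n,q)`,
i.e. `K` is an `(n-t)`-blocking set. -/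
def BlocksDim (n t : ℕ) (K : Set (PGPoint F n)) : Prop :=
  ∀ W : Submodule F (Fin (n + 1) → F), finrank F W = t + 1 → (K ∩ projSet F n W).Nonempty

/-- `A` is a hyperoval of the plane (rank-3 subspace) `Wt` of `PG(n,q)`: a set of
`q + 2` points of the plane meeting every line of the plane in exactly `0` or `2`
points. -/
def IsHyperoval (n q : ℕ) (Wt : Submodule F (Fin (n + 1) → F)) (A : Set (PGPoint F n)) : Prop :=
  A ⊆ projSet F n Wt ∧ A.ncard = q + 2 ∧
  ∀ L : Submodule F (Fin (n + 1) → F), L ≤ Wt → finrank F L = 2 →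
    (A ∩ projSet F n L).ncard = 0 ∨ (A ∩ projSet F n L).ncard = 2

/-- `A` is a maximal arc of degree `d` in the plane (rank-3 subspace) `Wt` of `PG(n,q)`:
a nonempty set of points of the plane meeting every line of the plane in exactly `0`
or `d` points. -/
def IsMaximalArc (n d : ℕ) (Wt : Submodule F (Fin (n + 1) → F)) (A : Set (PGPoint F n)) : Prop :=
  A ⊆ projSet F n Wt ∧ A.Nonempty ∧
  ∀ L : Submodule F (Fin (n + 1) → F), L ≤ Wt → finrank F L = 2 →
    (A ∩ projSet F n L).ncard = 0 ∨ (A ∩ projSet F n L).ncard = d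

section VectorSpace

open Classical in
/-- The members of the pencil spanned by two functionals, counted against a finite set. -/
theorem sum_card_pencil {F : Type*} [Field F] [Fintype F] {E : Type*} [AddCommGroup E]
    [Module F E] (X : Finset E) (f g : Dual F E) :
    ∑ t : F, (X.filter fun v => (g - t • f) v = 0).card + (X.filter fun v => f v = 0).card =
      X.card + Fintype.card F * (X.filter fun v => f v = 0 ∧ g v = 0).card := by
  simp only [Finset.card_filter, Finset.card_eq_sum_ones X]
  rw [Finset.sum_comm, ← Finset.sum_add_distrib, Finset.mul_sum, ← Finset.sum_add_distrib]
  refine Finset.sum_congr rfl fun v _ => ?_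
  by_cases hf : f v = 0
  · by_cases hg : g v = 0 <;> simp [hf, hg]
    ring
  · have h : ∀ t : F, (g - t • f) v = 0 ↔ t = g v / f v := fun t => by
      rw [LinearMap.sub_apply, LinearMap.smul_apply, smul_eq_mul, sub_eq_zero, eq_div_iff hf,
        eq_comm]
    simp only [h, hf, false_and, if_false, add_zero, mul_zero, Finset.sum_ite_eq',
      Finset.mem_univ, if_true]

/-- If every subspace `S ⊔ ⟨e⟩` with `e ∉ S` contains a nonzero vector of a cone `X` that meets
`S` trivially, then `X` surjects onto `E ⧸ S`. -/
theorem exists_mem_mkQ_eq {F : Type*} [Field F] {E : Type*} [AddCommGroup E]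
    [Module F E] {X : Finset E} (h0 : (0 : E) ∈ X) (hsmul : ∀ (r : F), ∀ v ∈ X, r • v ∈ X)
    (S : Submodule F E) (hS : ∀ v ∈ X, v ∈ S → v = 0)
    (hblock : ∀ e ∉ S, ∃ v ∈ X, v ∈ S ⊔ F ∙ e ∧ v ≠ 0) (u : E ⧸ S) :
    ∃ v ∈ X, S.mkQ v = u := by
  obtain ⟨e, rfl⟩ := S.mkQ_surjective u
  by_cases he : e ∈ S
  · exact ⟨0, h0, by simpa using ((Submodule.Quotient.mk_eq_zero S).2 he).symm⟩
  obtain ⟨v, hvX, hv, hv0⟩ := hblock e he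
  obtain ⟨s, hs, z, hz, rfl⟩ := Submodule.mem_sup.1 hv
  obtain ⟨r, rfl⟩ := Submodule.mem_span_singleton.1 hz
  have hr : r ≠ 0 := by
    rintro rfl
    exact hv0 (hS _ hvX (by simpa using hs))
  refine ⟨r⁻¹ • (s + r • e), hsmul _ _ hvX, ?_⟩
  have : S.mkQ s = 0 := (Submodule.Quotient.mk_eq_zero S).2 hs
  rw [map_smul, map_add, this, zero_add, map_smul, smul_smul, inv_mul_cancel₀ hr, one_smul]

theorem finrank_sup_span_singleton {F : Type*} [Field F] {E : Type*} [AddCommGroup E]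
    [Module F E] [FiniteDimensional F E] {S : Submodule F E} {e : E} (he : e ∉ S) :
    finrank F (S ⊔ F ∙ e : Submodule F E) = finrank F S + 1 := by
  have hinf : S ⊓ F ∙ e = ⊥ := by
    rw [← disjoint_iff, Submodule.disjoint_span_singleton' (by rintro rfl; exact he S.zero_mem)]
    exact he
  have := Submodule.finrank_sup_add_finrank_inf_eq S (F ∙ e)
  rw [hinf, finrank_bot, finrank_span_singleton (by rintro rfl; exact he S.zero_mem)] at this
  simpa using this

/-- The equality case of the Bose–Burton theorem for sets meeting every plane. -/
theorem add_mem_of_blocks_planes {F : Type*} [Field F] [Fintype F] {E : Type*} [AddCommGroup E]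
    [Module F E] [FiniteDimensional F E] {X : Finset E} (h0 : (0 : E) ∈ X)
    (hsmul : ∀ (r : F), ∀ v ∈ X, r • v ∈ X)
    (hblock : ∀ P : Submodule F E, finrank F P = 3 → ∃ v ∈ X, v ∈ P ∧ v ≠ 0)
    {m : ℕ} (hE : finrank F E = m + 3) (hX : X.card = Fintype.card F ^ (m + 1))
    {x y : E} (hx : x ∈ X) (hy : y ∈ X) : x + y ∈ X := by
  classical
  have : Finite E := Module.finite_of_finite F
  by_contra hp
  have hp0 : x + y ≠ 0 := fun h => hp (h ▸ h0)
  have hspan : ∀ v ∈ X, v ∈ F ∙ (x + y) → v = 0 := by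
    intro v hv hvp
    obtain ⟨r, rfl⟩ := Submodule.mem_span_singleton.1 hvp
    by_contra hr
    have hr : r ≠ 0 := by rintro rfl; simp at hr
    apply hp
    simpa [smul_smul, hr] using hsmul r⁻¹ _ hv
  have hcard : ∀ S : Submodule F E, Nat.card (E ⧸ S) = Fintype.card F ^ (m + 3 - finrank F S) :=
    fun S => by
      rw [Module.natCard_eq_pow_finrank (K := F), Nat.card_eq_fintype_card, ← hE,
        S.finrank_quotient]
  have hq : 1 < Fintype.card F := Fintype.one_lt_card
  by_cases hL : ∀ e ∉ F ∙ (x + y), ∃ v ∈ X, v ∈ (F ∙ (x + y)) ⊔ F ∙ e ∧ v ≠ 0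
  · have hsurj := exists_mem_mkQ_eq h0 hsmul _ hspan hL
    have hle : Nat.card (E ⧸ F ∙ (x + y)) ≤ X.card := by
      rw [← Nat.card_eq_finsetCard X]
      exact Nat.card_le_card_of_surjective (fun v : X => (F ∙ (x + y)).mkQ v) fun u => by
        obtain ⟨v, hv, h⟩ := hsurj u
        exact ⟨⟨v, hv⟩, h⟩
    rw [hcard, hX, finrank_span_singleton hp0, Nat.pow_le_pow_iff_right hq] at hle
    omega
  · push Not at hL
    obtain ⟨e, he, hL⟩ := hL
    set L := (F ∙ (x + y)) ⊔ F ∙ e with hLdef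
    have hLr : finrank F L = 2 := by
      rw [finrank_sup_span_singleton he, finrank_span_singleton hp0]
    have hsurj := exists_mem_mkQ_eq h0 hsmul L hL fun e' he' =>
      hblock _ (by rw [finrank_sup_span_singleton he', hLr])
    have hbij : Function.Bijective (fun v : X => L.mkQ v) := by
      refine Function.Surjective.bijective_of_nat_card_le (fun u => ?_) ?_
      · obtain ⟨v, hv, h⟩ := hsurj u
        exact ⟨⟨v, hv⟩, h⟩
      · rw [hcard, hLr, Nat.card_eq_finsetCard, hX]
        exact le_of_eq (by congr 1)
    have hy' : -y ∈ X := by simpa using hsmul (-1) y hy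
    have heq : L.mkQ x = L.mkQ (-y) := by
      rw [← sub_eq_zero, ← map_sub, sub_neg_eq_add]
      exact (Submodule.Quotient.mk_eq_zero L).2
        (le_sup_left (a := F ∙ (x + y)) (Submodule.mem_span_singleton_self _))
    have := hbij.1 (a₁ := ⟨x, hx⟩) (a₂ := ⟨-y, hy'⟩) heq
    exact hp0 (by rw [Subtype.mk.inj this, neg_add_cancel])

/-- The arithmetic of the two kinds of pencils through a hyperplane meeting the set minimally. -/
theorem pencil_counts {q D β γ β' γ' N : ℕ} (hq : 0 < q) (hD : 0 < D) (hco : Nat.Coprime D q)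
    (hβ : β ≤ q) (hβ' : β' ≤ q) (h : N = β * ((q + 1) * D) + γ * (q * (D + 1)))
    (h' : N = q + β' * ((q + 1) * D) + γ' * (q * (D + 1))) :
    (β = 0 ∧ β' = q) ∨ (β = q ∧ β' = 0) := by
  have hmod : (q : ℤ) ∣ (β - β') * D := by
    refine ⟨1 + β' * D + γ' * (D + 1) - β * D - γ * (D + 1), ?_⟩
    have : (β * ((q + 1) * D) + γ * (q * (D + 1)) : ℤ) =
      q + β' * ((q + 1) * D) + γ' * (q * (D + 1)) := by exact_mod_cast h.symm.trans h'
    linear_combination this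
  have hdvd : (q : ℤ) ∣ β - β' :=
    (Nat.isCoprime_iff_coprime.2 hco.symm).dvd_of_dvd_mul_right hmod
  obtain ⟨k, hk⟩ := hdvd
  have hk1 : k ≤ 1 := by nlinarith
  have hk2 : -1 ≤ k := by nlinarith
  interval_cases k
  · left; constructor <;> omega
  · exfalso
    have hbb : β = β' := by omega
    subst hbb
    have h3 : γ * (q * (D + 1)) = q + γ' * (q * (D + 1)) := by omega
    have h4 : q * (γ * (D + 1)) = q * (1 + γ' * (D + 1)) := by linarith
    have h5 := Nat.eq_of_mul_eq_mul_left hq h4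
    have h6 : (D + 1) ∣ 1 := (Nat.dvd_add_left (Dvd.intro_left γ' rfl)).1 (h5 ▸ Dvd.intro_left γ rfl)
    have := Nat.le_of_dvd one_pos h6
    omega
  · right; constructor <;> omega

theorem card_eq_pow_of_mem_iff {F : Type*} [Field F] [Fintype F] {E : Type*} [AddCommGroup E]
    [Module F E] [FiniteDimensional F E] {Y : Finset E} {S : Submodule F E}
    (h : ∀ v, v ∈ Y ↔ v ∈ S) : Y.card = Fintype.card F ^ finrank F S := by
  rw [← Nat.card_eq_fintype_card (α := F), ← Module.natCard_eq_pow_finrank (K := F),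
    ← Nat.card_eq_finsetCard]
  exact Nat.card_congr (Equiv.subtypeEquivRight h)

theorem finrank_inf_ker_add_one {F : Type*} [Field F] {E : Type*} [AddCommGroup E]
    [Module F E] [FiniteDimensional F E] {V : Submodule F E} {g : Dual F E}
    (hg : g ∉ V.dualAnnihilator) :
    finrank F (V ⊓ LinearMap.ker g : Submodule F E) + 1 = finrank F V := by
  rw [← Submodule.map_comap_subtype, Submodule.finrank_map_subtype_eq, ← LinearMap.ker_comp]
  refine Module.Dual.finrank_ker_add_one_of_ne_zero (f := g ∘ₗ V.subtype) fun h => hg ?_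
  rw [Submodule.mem_dualAnnihilator]
  exact fun v hv => LinearMap.congr_fun h ⟨v, hv⟩

theorem sum_of_three_values {ι : Type*} [Fintype ι] (u : ι → ℕ) {a k B C : ℕ} (hk : 0 < k)
    (hB : 0 < B) (hC : 0 < C) (hBC : B ≠ C)
    (hu : ∀ t, u t = a ∨ u t = a + k * B ∨ u t = a + k * C) :
    ∑ t, u t = Fintype.card ι * a + k * ((Finset.univ.filter fun t => u t = a + k * B).card * B +
      (Finset.univ.filter fun t => u t = a + k * C).card * C) := by
  have hkB : k * B ≠ 0 := by positivity
  have hkC : k * C ≠ 0 := by positivity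
  have hkBC : k * B ≠ k * C := fun h => hBC (Nat.eq_of_mul_eq_mul_left hk h)
  have key : ∀ t, u t = a + k * ((if u t = a + k * B then 1 else 0) * B +
      (if u t = a + k * C then 1 else 0) * C) := by
    intro t
    rcases hu t with h | h | h <;> rw [h]
    · rw [if_neg (by omega), if_neg (by omega)]; simp
    · rw [if_pos rfl, if_neg (by omega)]; simp
    · rw [if_pos rfl, if_neg (by omega)]; simp
  rw [Finset.sum_congr rfl fun t _ => key t, Finset.sum_add_distrib, ← Finset.mul_sum,
    Finset.sum_add_distrib, ← Finset.sum_mul, ← Finset.sum_mul, Finset.card_filter,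
    Finset.card_filter]
  simp

theorem finrank_dualAnnihilator {F : Type*} [Field F] {E : Type*} [AddCommGroup E]
    [Module F E] [FiniteDimensional F E] (V : Submodule F E) :
    finrank F V + finrank F V.dualAnnihilator = finrank F E :=
  Subspace.finrank_add_finrank_dualAnnihilator_eq V

theorem exists_mem_notMem_of_finrank_lt {F : Type*} [Field F] {E : Type*} [AddCommGroup E]
    [Module F E] [FiniteDimensional F E] {A B : Submodule F E} (h : finrank F B < finrank F A) :
    ∃ g ∈ A, g ∉ B := by
  by_contra! hAB
  exact absurd (Submodule.finrank_mono (show A ≤ B from hAB)) (by omega)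

open Classical in
/-- The number of vectors of `X` in the kernel of `f`. -/
def kerCount {F : Type*} [Field F] {E : Type*} [AddCommGroup E] [Module F E] (X : Finset E)
    (f : Dual F E) : ℕ :=
  (X.filter fun v => f v = 0).card

/-- The vectors over a plane blocking set of `PG(m+3,q)` whose hyperplane intersection numbers are
those of a cone with `m`-dimensional vertex over a maximal arc of degree `D + 1`. -/
structure IsArcConeLike (F : Type*) [Field F] [Fintype F] {E : Type*} [AddCommGroup E]
    [Module F E] (m D : ℕ) (X : Finset E) : Prop where
  zero_mem : (0 : E) ∈ X
  smul_mem : ∀ (r : F), ∀ v ∈ X, r • v ∈ X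
  blocks : ∀ P : Submodule F E, finrank F P = 3 → ∃ v ∈ X, v ∈ P ∧ v ≠ 0
  finrank_eq : finrank F E = m + 4
  pos : 0 < D
  lt_card : D < Fintype.card F
  coprime : Nat.Coprime D (Fintype.card F)
  kerCount_eq : ∀ f : Dual F E, f ≠ 0 → kerCount X f = Fintype.card F ^ (m + 1) ∨
    kerCount X f = Fintype.card F ^ (m + 1) +
      (Fintype.card F - 1) * Fintype.card F ^ m * ((Fintype.card F + 1) * D) ∨
    kerCount X f = Fintype.card F ^ (m + 1) +
      (Fintype.card F - 1) * Fintype.card F ^ m * (Fintype.card F * (D + 1))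

open Classical in
/-- The number of members `g - t • f` of a pencil whose kernel contains the middle number of
vectors of `X`. -/
def midCount {F : Type*} [Field F] [Fintype F] {E : Type*} [AddCommGroup E] [Module F E]
    (m D : ℕ) (X : Finset E) (f g : Dual F E) : ℕ :=
  (Finset.univ.filter fun t : F => kerCount X (g - t • f) = Fintype.card F ^ (m + 1) +
    (Fintype.card F - 1) * Fintype.card F ^ m * ((Fintype.card F + 1) * D)).card

open Classical in
/-- The number of members `g - t • f` of a pencil whose kernel contains the largest number of
vectors of `X`. -/
def maxCount {F : Type*} [Field F] [Fintype F] {E : Type*} [AddCommGroup E] [Module F E]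
    (m D : ℕ) (X : Finset E) (f g : Dual F E) : ℕ :=
  (Finset.univ.filter fun t : F => kerCount X (g - t • f) = Fintype.card F ^ (m + 1) +
    (Fintype.card F - 1) * Fintype.card F ^ m * (Fintype.card F * (D + 1))).card

/-- `V` is the vertex cut out of `X` by a hyperplane `ker f` meeting `X` in the least possible
number of points. -/
structure IsVertex {F : Type*} [Field F] {E : Type*} [AddCommGroup E] [Module F E]
    (m : ℕ) (X : Finset E) (f : Dual F E) (V : Submodule F E) : Prop where
  ne_zero : f ≠ 0
  finrank_eq : finrank F V = m + 1
  mem_iff : ∀ v, v ∈ V ↔ v ∈ X ∧ f v = 0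

theorem IsVertex.mem_dualAnnihilator {F : Type*} [Field F] {E : Type*} [AddCommGroup E]
    [Module F E] {m : ℕ} {X : Finset E} {f : Dual F E} {V : Submodule F E}
    (hV : IsVertex m X f V) : f ∈ V.dualAnnihilator :=
  (Submodule.mem_dualAnnihilator _).2 fun v hv => ((hV.mem_iff v).1 hv).2

namespace IsArcConeLike

variable {F : Type*} [Field F] [Fintype F] {E : Type*} [AddCommGroup E] [Module F E]
  {m D : ℕ} {X : Finset E}

theorem exists_isVertex [FiniteDimensional F E] (hX : IsArcConeLike F m D X) {f : Dual F E} (hf : f ≠ 0)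
    (h : kerCount X f = Fintype.card F ^ (m + 1)) : ∃ V, IsVertex m X f V := by
  classical
  set H := LinearMap.ker f with hH
  have hHr : finrank F H = m + 3 := by
    have : finrank F H + 1 = finrank F E := Module.Dual.finrank_ker_add_one_of_ne_zero hf
    rw [hX.finrank_eq] at this
    omega
  have hmem : ∀ v : H, v ∈ X.subtype (· ∈ H) ↔ (v : E) ∈ X := fun v => Finset.mem_subtype
  have hadd : ∀ x y : H, (x : E) ∈ X → (y : E) ∈ X → ((x + y : H) : E) ∈ X := by
    intro x y hx hy
    rw [← hmem] at *
    refine add_mem_of_blocks_planes (F := F) ?_ ?_ ?_ hHr ?_ hx hy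
    · simpa using hX.zero_mem
    · intro r v hv
      rw [hmem] at *
      exact hX.smul_mem r _ hv
    · intro P hP
      obtain ⟨v, hv, hvP, hv0⟩ := hX.blocks (P.map H.subtype)
        (by rw [Submodule.finrank_map_subtype_eq, hP])
      obtain ⟨w, hw, rfl⟩ := hvP
      exact ⟨w, by simpa using hv, hw, by rintro rfl; exact hv0 rfl⟩
    · rw [← h, kerCount, Finset.card_subtype]
      rfl
  let V : Submodule F E :=
    { carrier := {v | v ∈ X ∧ f v = 0}
      add_mem' := fun {x y} hx hy =>
        ⟨hadd ⟨x, hx.2⟩ ⟨y, hy.2⟩ hx.1 hy.1, by rw [map_add, hx.2, hy.2, add_zero]⟩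
      zero_mem' := ⟨hX.zero_mem, map_zero f⟩
      smul_mem' := fun r x hx => ⟨hX.smul_mem r x hx.1, by rw [map_smul, hx.2, smul_zero]⟩ }
  refine ⟨V, hf, ?_, fun v => Iff.rfl⟩
  have hc := card_eq_pow_of_mem_iff (S := V) (Y := X.filter fun v => f v = 0)
    fun v => by rw [Finset.mem_filter]; rfl
  exact Nat.pow_right_injective (Fintype.one_lt_card (α := F)) (hc.symm.trans h)

theorem weights_ne (hX : IsArcConeLike F m D X) :
    Fintype.card F ^ (m + 1) +
      (Fintype.card F - 1) * Fintype.card F ^ m * ((Fintype.card F + 1) * D) ≠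
    Fintype.card F ^ (m + 1) +
      (Fintype.card F - 1) * Fintype.card F ^ m * (Fintype.card F * (D + 1)) := by
  have hq : 1 < Fintype.card F := Fintype.one_lt_card
  have h2 := hX.lt_card
  have hk : 0 < (Fintype.card F - 1) * Fintype.card F ^ m :=
    Nat.mul_pos (by omega) (by positivity)
  intro h
  have := Nat.eq_of_mul_eq_mul_left hk (Nat.add_left_cancel h)
  nlinarith

theorem midCount_add_maxCount_le (hX : IsArcConeLike F m D X) (f g : Dual F E) :
    midCount m D X f g + maxCount m D X f g ≤ Fintype.card F := by
  classical
  rw [midCount, maxCount, ← Finset.card_union_of_disjoint]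
  · exact Finset.card_le_univ _
  · exact Finset.disjoint_filter.2 fun t _ h h' => hX.weights_ne (h.symm.trans h')

theorem sum_kerCount (hX : IsArcConeLike F m D X) {f g : Dual F E} (h : g ∉ F ∙ f) :
    ∑ t : F, kerCount X (g - t • f) = Fintype.card F * Fintype.card F ^ (m + 1) +
      (Fintype.card F - 1) * Fintype.card F ^ m *
      (midCount m D X f g * ((Fintype.card F + 1) * D) +
        maxCount m D X f g * (Fintype.card F * (D + 1))) := by
  have hq : 1 < Fintype.card F := Fintype.one_lt_card
  have h1 := hX.pos
  have h2 := hX.lt_card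
  have hk : 0 < (Fintype.card F - 1) * Fintype.card F ^ m :=
    Nat.mul_pos (by omega) (by positivity)
  refine sum_of_three_values _ hk (by positivity) (by positivity) (by intro h; nlinarith) ?_
  refine fun t => hX.kerCount_eq _ fun h0 => h ?_
  rw [sub_eq_zero.1 h0]
  exact Submodule.smul_mem _ _ (Submodule.mem_span_singleton_self f)

theorem kerCount_vertex [FiniteDimensional F E] {f : Dual F E} {V : Submodule F E}
    (hV : IsVertex m X f V) : kerCount X f = Fintype.card F ^ (m + 1) := by
  classical
  rw [kerCount, card_eq_pow_of_mem_iff (S := V) fun v => by rw [Finset.mem_filter, hV.mem_iff],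
    hV.finrank_eq]

theorem card_of_mem [FiniteDimensional F E] (hX : IsArcConeLike F m D X) {f g : Dual F E}
    {V : Submodule F E} (hV : IsVertex m X f V) (hg : g ∈ V.dualAnnihilator) (h : g ∉ F ∙ f) :
    X.card = Fintype.card F ^ (m + 1) + (Fintype.card F - 1) * Fintype.card F ^ m *
      (midCount m D X f g * ((Fintype.card F + 1) * D) +
        maxCount m D X f g * (Fintype.card F * (D + 1))) := by
  classical
  have h1 := sum_card_pencil X f g
  have h2 : (X.filter fun v => f v = 0 ∧ g v = 0).card = Fintype.card F ^ (m + 1) := by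
    rw [card_eq_pow_of_mem_iff (S := V), hV.finrank_eq]
    intro v
    rw [Finset.mem_filter, hV.mem_iff]
    exact ⟨fun h => ⟨h.1, h.2.1⟩, fun h => ⟨h.1, h.2,
      (Submodule.mem_dualAnnihilator _).1 hg v ((hV.mem_iff v).2 h)⟩⟩
  have h3 := hX.sum_kerCount h
  have h4 := kerCount_vertex hV
  unfold kerCount at h3 h4
  rw [h3, h4, h2] at h1
  linarith

theorem card_of_notMem [FiniteDimensional F E] (hX : IsArcConeLike F m D X) {f g : Dual F E}
    {V : Submodule F E} (hV : IsVertex m X f V) (hg : g ∉ V.dualAnnihilator) :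
    X.card = Fintype.card F ^ (m + 1) + (Fintype.card F - 1) * Fintype.card F ^ m *
      (Fintype.card F + midCount m D X f g * ((Fintype.card F + 1) * D) +
        maxCount m D X f g * (Fintype.card F * (D + 1))) := by
  classical
  have h1 := sum_card_pencil X f g
  have h2 : (X.filter fun v => f v = 0 ∧ g v = 0).card = Fintype.card F ^ m := by
    rw [card_eq_pow_of_mem_iff (S := V ⊓ LinearMap.ker g)]
    · have := finrank_inf_ker_add_one hg
      rw [hV.finrank_eq] at this
      rw [Nat.add_right_cancel this]
    · intro v
      rw [Finset.mem_filter, Submodule.mem_inf, hV.mem_iff, LinearMap.mem_ker, and_assoc]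
  have h3 := hX.sum_kerCount (f := f) (g := g) fun h =>
    hg ((Submodule.span_singleton_le_iff_mem _ _).2 hV.mem_dualAnnihilator h)
  have h4 := kerCount_vertex hV
  unfold kerCount at h3 h4
  rw [h3, h4, h2] at h1
  obtain ⟨r, hr⟩ : ∃ r, Fintype.card F = r + 1 := ⟨_, (Nat.succ_pred Fintype.card_ne_zero).symm⟩
  rw [hr] at h1 ⊢
  rw [Nat.add_sub_cancel] at h1 ⊢
  rw [pow_succ] at h1 ⊢
  linarith

theorem exists_mem_notMem_span [FiniteDimensional F E] (hX : IsArcConeLike F m D X)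
    {f : Dual F E} {V : Submodule F E} (hV : IsVertex m X f V) :
    ∃ g ∈ V.dualAnnihilator, g ∉ F ∙ f := by
  apply exists_mem_notMem_of_finrank_lt
  have := finrank_dualAnnihilator V
  rw [hV.finrank_eq, hX.finrank_eq] at this
  rw [finrank_span_singleton hV.ne_zero]
  omega

theorem exists_notMem_dualAnnihilator [FiniteDimensional F E] (hX : IsArcConeLike F m D X)
    {f : Dual F E} {V : Submodule F E} (hV : IsVertex m X f V) :
    ∃ g, g ∉ V.dualAnnihilator := by
  obtain ⟨g, -, hg⟩ := exists_mem_notMem_of_finrank_lt (A := (⊤ : Submodule F (Dual F E)))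
    (B := V.dualAnnihilator) (by
      have := finrank_dualAnnihilator V
      rw [hV.finrank_eq, hX.finrank_eq] at this
      rw [finrank_top, Subspace.dual_finrank_eq, hX.finrank_eq]
      omega)
  exact ⟨g, hg⟩

theorem midCount_cases [FiniteDimensional F E] (hX : IsArcConeLike F m D X) {f g g' : Dual F E}
    {V : Submodule F E} (hV : IsVertex m X f V) (hg : g ∈ V.dualAnnihilator) (h : g ∉ F ∙ f)
    (hg' : g' ∉ V.dualAnnihilator) :
    (midCount m D X f g = 0 ∧ midCount m D X f g' = Fintype.card F) ∨
      (midCount m D X f g = Fintype.card F ∧ midCount m D X f g' = 0) := by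
  have hq : 1 < Fintype.card F := Fintype.one_lt_card
  have hk : 0 < (Fintype.card F - 1) * Fintype.card F ^ m :=
    Nat.mul_pos (by omega) (by positivity)
  have h1 := hX.midCount_add_maxCount_le f g
  have h2 := hX.midCount_add_maxCount_le f g'
  refine pencil_counts (by omega) hX.pos hX.coprime (by omega) (by omega) rfl
    (Nat.eq_of_mul_eq_mul_left hk (Nat.add_left_cancel
      ((hX.card_of_mem hV hg h).symm.trans (hX.card_of_notMem hV hg'))))

theorem kerCount_eq_of_midCount_eq_card {f g : Dual F E}
    (h : midCount m D X f g = Fintype.card F) (t : F) :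
    kerCount X (g - t • f) = Fintype.card F ^ (m + 1) +
      (Fintype.card F - 1) * Fintype.card F ^ m * ((Fintype.card F + 1) * D) := by
  classical
  rw [midCount, Finset.card_eq_iff_eq_univ] at h
  have ht := Finset.mem_univ t
  rw [← h, Finset.mem_filter] at ht
  exact ht.2

theorem kerCount_ne_of_midCount_eq_zero {f g : Dual F E}
    (h : midCount m D X f g = 0) (t : F) :
    kerCount X (g - t • f) ≠ Fintype.card F ^ (m + 1) +
      (Fintype.card F - 1) * Fintype.card F ^ m * ((Fintype.card F + 1) * D) := by
  classical
  rw [midCount, Finset.card_eq_zero] at h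
  exact Finset.filter_eq_empty_iff.1 h (Finset.mem_univ t)

/-- If some pencil in the dual of the vertex consisted of middle hyperplanes, then there would be a
second vertex. -/
theorem exists_kerCount_eq_of_midCount_eq [FiniteDimensional F E] (hX : IsArcConeLike F m D X)
    {f g g' : Dual F E} {V : Submodule F E} (hV : IsVertex m X f V) (hg : g ∈ V.dualAnnihilator)
    (h : g ∉ F ∙ f) (hg' : g' ∉ V.dualAnnihilator) (hmid : midCount m D X f g = Fintype.card F) :
    ∃ f', f' ∉ V.dualAnnihilator ∧ kerCount X f' = Fintype.card F ^ (m + 1) := by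
  classical
  have hq : 1 < Fintype.card F := Fintype.one_lt_card
  have hk : 0 < (Fintype.card F - 1) * Fintype.card F ^ m :=
    Nat.mul_pos (by omega) (by positivity)
  have hmid' : midCount m D X f g' = 0 := by
    rcases hX.midCount_cases hV hg h hg' with h1 | h1 <;> omega
  have hmem : ∀ t : F, g' - t • f ∉ V.dualAnnihilator := fun t ht => hg' <| by
    simpa using Submodule.add_mem _ ht (Submodule.smul_mem _ t hV.mem_dualAnnihilator)
  by_contra! hno
  have hmax : maxCount m D X f g' = Fintype.card F := by
    rw [maxCount, Finset.card_eq_iff_eq_univ, Finset.filter_eq_self]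
    intro t _
    rcases hX.kerCount_eq (g' - t • f) fun h0 => hmem t (h0 ▸ Submodule.zero_mem _) with h1 | h1 | h1
    · exact absurd h1 (hno _ (hmem t))
    · exact absurd h1 (kerCount_ne_of_midCount_eq_zero hmid' t)
    · exact h1
  have h0 : maxCount m D X f g = 0 := by
    have := hX.midCount_add_maxCount_le f g
    omega
  have heq := Nat.eq_of_mul_eq_mul_left hk (Nat.add_left_cancel
      ((hX.card_of_mem hV hg h).symm.trans (hX.card_of_notMem hV hg')))
  rw [hmid, hmid', h0, hmax] at heq
  have h3 : Fintype.card F * ((Fintype.card F + 1) * D) =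
      Fintype.card F * (1 + Fintype.card F * (D + 1)) := by linarith
  have h4 := Nat.eq_of_mul_eq_mul_left (by omega) h3
  have := hX.lt_card
  nlinarith

theorem midCount_eq_zero [FiniteDimensional F E] (hX : IsArcConeLike F m D X)
    {f g : Dual F E} {V : Submodule F E} (hV : IsVertex m X f V) (hg : g ∈ V.dualAnnihilator)
    (h : g ∉ F ∙ f) : midCount m D X f g = 0 := by
  have hq : 1 < Fintype.card F := Fintype.one_lt_card
  have hk : 0 < (Fintype.card F - 1) * Fintype.card F ^ m :=
    Nat.mul_pos (by omega) (by positivity)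
  obtain ⟨g', hg'⟩ := hX.exists_notMem_dualAnnihilator hV
  refine (hX.midCount_cases hV hg h hg').elim And.left fun hmid => ?_
  obtain ⟨f₁, hf₁, hf₁c⟩ := hX.exists_kerCount_eq_of_midCount_eq hV hg h hg' hmid.1
  have hf₁0 : f₁ ≠ 0 := by rintro rfl; exact hf₁ (Submodule.zero_mem _)
  obtain ⟨V₁, hV₁⟩ := hX.exists_isVertex hf₁0 hf₁c
  obtain ⟨g₁, hg₁, hg₁s, hg₁V⟩ : ∃ g₁ ∈ V₁.dualAnnihilator, g₁ ∉ F ∙ f₁ ∧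
      g₁ ∉ V.dualAnnihilator := by
    obtain ⟨g₁, hg₁, hg₁s⟩ := hX.exists_mem_notMem_span hV₁
    by_cases hm : g₁ ∈ V.dualAnnihilator
    · refine ⟨g₁ + f₁, Submodule.add_mem _ hg₁ hV₁.mem_dualAnnihilator, fun hs => hg₁s ?_,
        fun hs => hf₁ ?_⟩
      · exact (Submodule.add_mem_iff_left _ (Submodule.mem_span_singleton_self f₁)).1 hs
      · exact (Submodule.add_mem_iff_right _ hm).1 hs
    · exact ⟨g₁, hg₁, hg₁s, hm⟩
  have hne : kerCount X g₁ ≠ Fintype.card F ^ (m + 1) +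
      (Fintype.card F - 1) * Fintype.card F ^ m * ((Fintype.card F + 1) * D) := by
    have h1 : midCount m D X f g₁ = 0 := by
      rcases hX.midCount_cases hV hg h hg₁V with h1 | h1 <;> omega
    simpa using kerCount_ne_of_midCount_eq_zero h1 0
  obtain ⟨g₂, hg₂⟩ := hX.exists_notMem_dualAnnihilator hV₁
  rcases hX.midCount_cases hV₁ hg₁ hg₁s hg₂ with h1 | h1
  · have hmax : maxCount m D X f g = 0 := by
      have := hX.midCount_add_maxCount_le f g
      omega
    have heq := Nat.eq_of_mul_eq_mul_left hk (Nat.add_left_cancel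
      ((hX.card_of_mem hV hg h).symm.trans (hX.card_of_notMem hV₁ hg₂)))
    rw [hmid.1, hmax, h1.2] at heq
    omega
  · exact absurd (by simpa using kerCount_eq_of_midCount_eq_card h1.1 0) hne

theorem kerCount_of_mem [FiniteDimensional F E] (hX : IsArcConeLike F m D X)
    {f g : Dual F E} {V : Submodule F E} (hV : IsVertex m X f V) (hg : g ∈ V.dualAnnihilator)
    (h : g ≠ 0) : kerCount X g = Fintype.card F ^ (m + 1) ∨
      kerCount X g = Fintype.card F ^ (m + 1) +
        (Fintype.card F - 1) * Fintype.card F ^ m * (Fintype.card F * (D + 1)) := by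
  by_cases hs : g ∈ F ∙ f
  · obtain ⟨r, rfl⟩ := Submodule.mem_span_singleton.1 hs
    have hr : r ≠ 0 := by rintro rfl; simp at h
    left
    classical
    rw [← kerCount_vertex hV, kerCount, kerCount]
    congr 1
    exact Finset.filter_congr fun v _ => by simp [hr]
  · rcases hX.kerCount_eq g h with h1 | h1 | h1
    · exact Or.inl h1
    · exact absurd h1 (by simpa using kerCount_ne_of_midCount_eq_zero (hX.midCount_eq_zero hV hg hs) 0)
    · exact Or.inr h1

theorem card_eq [FiniteDimensional F E] (hX : IsArcConeLike F m D X)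
    {f : Dual F E} {V : Submodule F E} (hV : IsVertex m X f V) :
    X.card = Fintype.card F ^ (m + 1) + (Fintype.card F - 1) * Fintype.card F ^ m *
      (Fintype.card F + Fintype.card F * ((Fintype.card F + 1) * D)) := by
  have hq : 1 < Fintype.card F := Fintype.one_lt_card
  obtain ⟨g, hg, h⟩ := hX.exists_mem_notMem_span hV
  obtain ⟨g', hg'⟩ := hX.exists_notMem_dualAnnihilator hV
  have h0 := hX.midCount_eq_zero hV hg h
  have h1 : midCount m D X f g' = Fintype.card F := by
    rcases hX.midCount_cases hV hg h hg' with h1 | h1 <;> omega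
  have h2 : maxCount m D X f g' = 0 := by
    have := hX.midCount_add_maxCount_le f g'
    omega
  rw [hX.card_of_notMem hV hg', h1, h2, zero_mul, add_zero]

/-- `X` is a union of cosets of the vertex. -/
theorem add_mem_of_mem_vertex [FiniteDimensional F E] (hX : IsArcConeLike F m D X)
    {f : Dual F E} {V : Submodule F E} (hV : IsVertex m X f V) {x v : E} (hx : x ∈ X)
    (hv : v ∈ V) : x + v ∈ X := by
  classical
  by_cases hxV : x ∈ V
  · exact ((hV.mem_iff _).1 (V.add_mem hxV hv)).1
  set P := V ⊔ F ∙ x with hP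
  have hPr : finrank F P = m + 2 := by rw [finrank_sup_span_singleton hxV, hV.finrank_eq]
  have hxP : x ∈ P := Submodule.mem_sup_right (Submodule.mem_span_singleton_self x)
  have hPa : finrank F P.dualAnnihilator = 2 := by
    have := finrank_dualAnnihilator P
    rw [hPr, hX.finrank_eq] at this
    omega
  have hle : P.dualAnnihilator ≤ V.dualAnnihilator :=
    Submodule.dualAnnihilator_anti le_sup_left
  obtain ⟨f₁, hf₁, hf₁0⟩ := exists_mem_notMem_of_finrank_lt (A := P.dualAnnihilator)
    (B := (⊥ : Submodule F (Dual F E))) (by rw [finrank_bot, hPa]; norm_num)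
  have hf₁0 : f₁ ≠ 0 := hf₁0
  obtain ⟨g₁, hg₁, hg₁s⟩ := exists_mem_notMem_of_finrank_lt (A := P.dualAnnihilator)
    (B := F ∙ f₁) (by rw [finrank_span_singleton hf₁0, hPa]; norm_num)
  have hfull : ∀ g ∈ P.dualAnnihilator, g ≠ 0 → kerCount X g = Fintype.card F ^ (m + 1) +
      (Fintype.card F - 1) * Fintype.card F ^ m * (Fintype.card F * (D + 1)) := by
    intro g hg hg0
    refine (hX.kerCount_of_mem hV (hle hg) hg0).resolve_left fun h => hxV ?_
    obtain ⟨V', hV'⟩ := hX.exists_isVertex hg0 h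
    have : V ≤ V' := fun w hw => (hV'.mem_iff w).2 ⟨((hV.mem_iff w).1 hw).1,
      (Submodule.mem_dualAnnihilator _).1 (hle hg) w hw⟩
    rw [Submodule.eq_of_le_of_finrank_eq this (by rw [hV.finrank_eq, hV'.finrank_eq])]
    exact (hV'.mem_iff x).2 ⟨hx, (Submodule.mem_dualAnnihilator _).1 hg x hxP⟩
  have hPmem : ∀ w, w ∈ P ↔ f₁ w = 0 ∧ g₁ w = 0 := by
    have hle' : P ≤ LinearMap.ker f₁ ⊓ LinearMap.ker g₁ := fun w hw =>
      ⟨(Submodule.mem_dualAnnihilator _).1 hf₁ w hw, (Submodule.mem_dualAnnihilator _).1 hg₁ w hw⟩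
    have hg₁' : g₁ ∉ (LinearMap.ker f₁).dualAnnihilator := fun hmem => by
      have h1 := finrank_dualAnnihilator (LinearMap.ker f₁)
      have h2 := Module.Dual.finrank_ker_add_one_of_ne_zero hf₁0
      have h3 : F ∙ f₁ ≤ (LinearMap.ker f₁).dualAnnihilator :=
        (Submodule.span_singleton_le_iff_mem _ _).2 <|
          (Submodule.mem_dualAnnihilator _).2 fun w hw => hw
      have h4 := Submodule.eq_of_le_of_finrank_eq h3
        (by rw [finrank_span_singleton hf₁0]; omega)
      exact hg₁s (h4 ▸ hmem)
    have h1 := finrank_inf_ker_add_one hg₁'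
    have h2 := Module.Dual.finrank_ker_add_one_of_ne_zero hf₁0
    rw [hX.finrank_eq] at h2
    have h3 := Submodule.eq_of_le_of_finrank_eq hle' (by omega)
    intro w
    rw [h3, Submodule.mem_inf, LinearMap.mem_ker, LinearMap.mem_ker]
  have hpencil := sum_card_pencil X f₁ g₁
  have hsum : ∀ t : F, (X.filter fun v => (g₁ - t • f₁) v = 0).card = _ := fun t =>
    hfull (g₁ - t • f₁) (Submodule.sub_mem _ hg₁ (Submodule.smul_mem _ _ hf₁)) fun h0 =>
      hg₁s (sub_eq_zero.1 h0 ▸ Submodule.smul_mem _ _ (Submodule.mem_span_singleton_self f₁))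
  have hcard : (X.filter fun v => f₁ v = 0 ∧ g₁ v = 0).card = Fintype.card F ^ (m + 2) := by
    rw [Finset.sum_congr rfl fun t _ => hsum t, Finset.sum_const, Finset.card_univ,
      show (X.filter fun v => f₁ v = 0).card = _ from hfull f₁ hf₁ hf₁0, hX.card_eq hV] at hpencil
    obtain ⟨r, hr⟩ : ∃ r, Fintype.card F = r + 1 :=
      ⟨_, (Nat.succ_pred Fintype.card_ne_zero).symm⟩
    refine Nat.eq_of_mul_eq_mul_left (Fintype.card_pos (α := F)) ?_
    rw [hr, Nat.add_sub_cancel] at hpencil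
    rw [hr]
    rw [smul_eq_mul] at hpencil
    simp only [pow_succ] at hpencil ⊢
    linarith
  have : Finite E := Module.finite_of_finite F
  have := Fintype.ofFinite E
  have hsub : (X.filter fun v => f₁ v = 0 ∧ g₁ v = 0) ⊆ Finset.univ.filter (· ∈ P) := by
    intro w hw
    rw [Finset.mem_filter] at hw
    simpa [hPmem] using hw.2
  have heq := Finset.eq_of_subset_of_card_le hsub (by
    rw [hcard, card_eq_pow_of_mem_iff (S := P) (by simp), hPr])
  have hxv : x + v ∈ Finset.univ.filter (· ∈ P) := by
    simpa using P.add_mem hxP (Submodule.mem_sup_left hv)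
  rw [← heq] at hxv
  exact (Finset.mem_filter.1 hxv).1

open Classical in
theorem card_filter_sup [FiniteDimensional F E] (hX : IsArcConeLike F m D X) {f : Dual F E}
    {V L : Submodule F E} (hV : IsVertex m X f V) (hVL : V ⊓ L = ⊥) :
    (X.filter (· ∈ V ⊔ L)).card =
      Fintype.card F ^ (m + 1) * (X.filter (· ∈ L)).card := by
  have h0 : ∀ v ∈ V, v ∈ L → v = 0 := fun v hv hl => by
    have : v ∈ V ⊓ L := ⟨hv, hl⟩
    simpa [hVL] using this
  have hcV := kerCount_vertex hV
  rw [kerCount] at hcV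
  rw [← hcV, ← Finset.card_product]
  symm
  refine Finset.card_nbij (fun p => p.2 + p.1) ?_ ?_ ?_
  · rintro ⟨v, l⟩ h
    simp only [Finset.mem_product, Finset.mem_filter, Finset.mem_coe, ← hV.mem_iff] at h ⊢
    exact ⟨hX.add_mem_of_mem_vertex hV h.2.1 h.1,
      Submodule.add_mem _ (Submodule.mem_sup_right h.2.2) (Submodule.mem_sup_left h.1)⟩
  · rintro ⟨v, l⟩ h ⟨v', l'⟩ h' heq
    simp only [Finset.mem_product, Finset.mem_filter, Finset.mem_coe, ← hV.mem_iff] at h h' heq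
    have hd : v - v' = l' - l := by
      rw [sub_eq_sub_iff_add_eq_add, add_comm v, heq]
    have hz := h0 (v - v') (V.sub_mem h.1 h'.1) (hd ▸ L.sub_mem h'.2.2 h.2.2)
    rw [Prod.mk.injEq]
    exact ⟨sub_eq_zero.1 hz, (sub_eq_zero.1 (hd.symm.trans hz)).symm⟩
  · intro w hw
    simp only [Finset.mem_filter, Finset.mem_coe] at hw
    obtain ⟨v, hv, l, hl, rfl⟩ := Submodule.mem_sup.1 hw.2
    refine ⟨(v, l), ?_, add_comm _ _⟩
    simp only [Finset.mem_product, Finset.mem_filter, Finset.mem_coe, ← hV.mem_iff]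
    refine ⟨hv, ?_, hl⟩
    simpa [add_comm, add_left_comm] using hX.add_mem_of_mem_vertex hV hw.1 (V.neg_mem hv)

end IsArcConeLike

theorem exists_dual_ker_eq {F : Type*} [Field F] {E : Type*} [AddCommGroup E]
    [Module F E] [FiniteDimensional F E] {W : Submodule F E}
    (hW : finrank F W + 1 = finrank F E) : ∃ f : Dual F E, f ≠ 0 ∧ LinearMap.ker f = W := by
  have h1 := finrank_dualAnnihilator W
  obtain ⟨f, hf, hf0⟩ := exists_mem_notMem_of_finrank_lt (A := W.dualAnnihilator)
    (B := (⊥ : Submodule F (Dual F E))) (by rw [finrank_bot]; omega)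
  have hf0 : f ≠ 0 := hf0
  refine ⟨f, hf0, (Submodule.eq_of_le_of_finrank_eq
    (fun w hw => (Submodule.mem_dualAnnihilator _).1 hf w hw) ?_).symm⟩
  have := Module.Dual.finrank_ker_add_one_of_ne_zero hf0
  omega

open Classical in
/-- A complement of the vertex meets `X` in the vectors over a maximal arc. -/
theorem IsArcConeLike.card_filter_of_disjoint {F : Type*} [Field F] [Fintype F] {E : Type*}
    [AddCommGroup E] [Module F E] [FiniteDimensional F E] {m D : ℕ} {X : Finset E}
    (hX : IsArcConeLike F m D X)
    {f : Dual F E} {V L : Submodule F E} (hV : IsVertex m X f V) (hVL : V ⊓ L = ⊥)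
    (hL : finrank F L = 2) :
    (X.filter (· ∈ L)).card = 1 ∨
      (X.filter (· ∈ L)).card = 1 + (Fintype.card F - 1) * (D + 1) := by
  have hW : finrank F (V ⊔ L : Submodule F E) + 1 = finrank F E := by
    have := Submodule.finrank_sup_add_finrank_inf_eq V L
    rw [hVL, finrank_bot, hV.finrank_eq, hL] at this
    rw [hX.finrank_eq]
    omega
  obtain ⟨g, hg0, hg⟩ := exists_dual_ker_eq hW
  have hgV : g ∈ V.dualAnnihilator := (Submodule.mem_dualAnnihilator _).2 fun v hv => by
    rw [← LinearMap.mem_ker, hg]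
    exact Submodule.mem_sup_left hv
  have hc : kerCount X g = Fintype.card F ^ (m + 1) * (X.filter (· ∈ L)).card := by
    rw [← hX.card_filter_sup hV hVL, kerCount]
    congr 1
    exact Finset.filter_congr fun v _ => by rw [← hg, LinearMap.mem_ker]
  have hpos : 0 < Fintype.card F ^ (m + 1) := pow_pos Fintype.card_pos _
  rcases hX.kerCount_of_mem hV hgV hg0 with h | h
  · left
    exact Nat.eq_of_mul_eq_mul_left hpos (by rw [← hc, h, mul_one])
  · right
    refine Nat.eq_of_mul_eq_mul_left hpos ?_
    rw [← hc, h, pow_succ]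
    ring

end VectorSpace

section Projective

variable {F : Type} [Field F] {n : ℕ}

theorem rep_mem_submodule (x : PGPoint F n) : x.rep ∈ x.submodule := by
  rw [Projectivization.submodule_eq]
  exact Submodule.mem_span_singleton_self _

theorem mem_projSet_iff {W : Submodule F (Fin (n + 1) → F)} {x : PGPoint F n} :
    x ∈ projSet F n W ↔ x.rep ∈ W := by
  change x.submodule ≤ W ↔ _
  rw [Projectivization.submodule_eq, Submodule.span_singleton_le_iff_mem]

variable [Fintype F]

open Classical in
/-- The vectors spanning points of `K`, together with zero. -/
def vectorsOver (K : Set (PGPoint F n)) : Finset (Fin (n + 1) → F) :=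
  Finset.univ.filter fun v => v = 0 ∨ ∃ x ∈ K, v ∈ x.submodule

theorem mem_vectorsOver {K : Set (PGPoint F n)} {v : Fin (n + 1) → F} :
    v ∈ vectorsOver K ↔ v = 0 ∨ ∃ x ∈ K, v ∈ x.submodule := by
  simp [vectorsOver]

theorem mk_mem_of_mem_vectorsOver {K : Set (PGPoint F n)} {v : Fin (n + 1) → F}
    (h : v ∈ vectorsOver K) (hv : v ≠ 0) : Projectivization.mk F v hv ∈ K := by
  obtain ⟨x, hx, hvx⟩ := (mem_vectorsOver.1 h).resolve_left hv
  convert hx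
  apply Projectivization.submodule_injective
  rw [Projectivization.submodule_mk]
  exact Submodule.eq_of_le_of_finrank_eq ((Submodule.span_singleton_le_iff_mem _ _).2 hvx)
    (by rw [finrank_span_singleton hv, x.finrank_submodule])

theorem rep_mem_vectorsOver {K : Set (PGPoint F n)} {x : PGPoint F n} :
    x.rep ∈ vectorsOver K ↔ x ∈ K := by
  refine ⟨fun h => ?_, fun h => mem_vectorsOver.2 (Or.inr ⟨x, h, rep_mem_submodule x⟩)⟩
  simpa using mk_mem_of_mem_vectorsOver h x.rep_nonzero

theorem smul_mem_vectorsOver {K : Set (PGPoint F n)} (r : F) {v : Fin (n + 1) → F}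
    (h : v ∈ vectorsOver K) : r • v ∈ vectorsOver K := by
  rw [mem_vectorsOver] at *
  rcases h with rfl | ⟨x, hx, hv⟩
  · exact Or.inl (smul_zero r)
  · exact Or.inr ⟨x, hx, x.submodule.smul_mem r hv⟩

open Classical in
theorem card_vectorsOver_filter (K : Set (PGPoint F n)) (W : Submodule F (Fin (n + 1) → F)) :
    ((vectorsOver K).filter (· ∈ W)).card =
      1 + (Fintype.card F - 1) * (K ∩ projSet F n W).ncard := by
  have hz : (0 : Fin (n + 1) → F) ∈ (vectorsOver K).filter (· ∈ W) :=
    Finset.mem_filter.2 ⟨mem_vectorsOver.2 (Or.inl rfl), W.zero_mem⟩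
  rw [← Finset.card_erase_add_one hz, add_comm, ← Fintype.card_units, ← Nat.card_eq_fintype_card,
    ← Nat.card_coe_set_eq, ← Nat.card_prod, ← Nat.card_eq_finsetCard]
  congr 1
  symm
  refine Nat.card_congr (Equiv.ofBijective (fun p => ⟨p.1 • (p.2 : PGPoint F n).rep, ?_⟩) ⟨?_, ?_⟩)
  · obtain ⟨a, x, hxK, hxW⟩ := p
    rw [Finset.mem_erase, Finset.mem_filter]
    exact ⟨(smul_ne_zero_iff_ne a).2 x.rep_nonzero,
      smul_mem_vectorsOver _ (rep_mem_vectorsOver.2 hxK),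
      W.smul_mem _ (mem_projSet_iff.1 hxW)⟩
  · rintro ⟨a, x, hx⟩ ⟨b, y, hy⟩ h
    have h : a • x.rep = b • y.rep := congrArg Subtype.val h
    have hxy : x = y := by
      rw [← x.mk_rep, ← y.mk_rep, Projectivization.mk_eq_mk_iff]
      exact ⟨a⁻¹ * b, by rw [mul_smul, ← h, inv_smul_smul]⟩
    subst hxy
    have hab : a = b := Units.ext (smul_left_injective F x.rep_nonzero h)
    subst hab
    rfl
  · rintro ⟨v, hv⟩
    rw [Finset.mem_erase, Finset.mem_filter] at hv
    obtain ⟨hv0, hvK, hvW⟩ := hv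
    obtain ⟨a, ha⟩ := Projectivization.exists_smul_eq_mk_rep F v hv0
    refine ⟨⟨a⁻¹, Projectivization.mk F v hv0, mk_mem_of_mem_vectorsOver hvK hv0, ?_⟩, ?_⟩
    · change (Projectivization.mk F v hv0).submodule ≤ W
      rw [Projectivization.submodule_mk, Submodule.span_singleton_le_iff_mem]
      exact hvW
    · exact Subtype.ext (by simp [← ha])

theorem one_add_sub_one_mul_theta {q : ℕ} (hq : 1 < q) (m : ℕ) :
    1 + (q - 1) * theta q m = q ^ (m + 1) := by
  rw [theta, Nat.mul_div_cancel' (by simpa using Nat.sub_dvd_pow_sub_pow q 1 (m + 1))]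
  have := Nat.one_le_pow (m + 1) q (by omega)
  omega

theorem kerCount_vectorsOver (K : Set (PGPoint F n)) (f : Dual F (Fin (n + 1) → F)) :
    kerCount (vectorsOver K) f =
      1 + (Fintype.card F - 1) * (K ∩ projSet F n (LinearMap.ker f)).ncard := by
  classical
  rw [← card_vectorsOver_filter, kerCount]
  simp only [LinearMap.mem_ker]

theorem isArcConeLike_vectorsOver {l D : ℕ} (hD : 0 < D) (hDq : D < Fintype.card F)
    (hco : Nat.Coprime D (Fintype.card F)) {K : Set (PGPoint F (l + 4))}
    (hblock : BlocksDim F (l + 4) 2 K)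
    (hK : ∀ W : Submodule F (Fin (l + 4 + 1) → F), finrank F W = l + 4 →
      (K ∩ projSet F (l + 4) W).ncard = theta (Fintype.card F) (l + 1) ∨
      (K ∩ projSet F (l + 4) W).ncard =
        Fintype.card F ^ (l + 1) * ((Fintype.card F + 1) * D + 1) + theta (Fintype.card F) l ∨
      (K ∩ projSet F (l + 4) W).ncard =
        Fintype.card F ^ (l + 2) * (D + 1) + theta (Fintype.card F) (l + 1)) :
    IsArcConeLike F (l + 1) D (vectorsOver K) where
  zero_mem := mem_vectorsOver.2 (Or.inl rfl)
  smul_mem r _ hv := smul_mem_vectorsOver r hv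
  blocks P hP := by
    obtain ⟨x, hxK, hxP⟩ := hblock P hP
    exact ⟨x.rep, rep_mem_vectorsOver.2 hxK, mem_projSet_iff.1 hxP, x.rep_nonzero⟩
  finrank_eq := by simp
  pos := hD
  lt_card := hDq
  coprime := hco
  kerCount_eq f hf := by
    have hr := Module.Dual.finrank_ker_add_one_of_ne_zero hf
    rw [finrank_fin_fun] at hr
    have hq : 1 < Fintype.card F := Fintype.one_lt_card
    have h1 := one_add_sub_one_mul_theta hq (l + 1)
    have h2 := one_add_sub_one_mul_theta hq l
    have hk : Fintype.card F = Fintype.card F - 1 + 1 := (Nat.sub_add_cancel hq.le).symm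
    rw [kerCount_vectorsOver]
    rcases hK _ (Nat.add_right_cancel hr) with h | h | h
    · exact Or.inl (by rw [h, h1])
    · refine Or.inr (Or.inl ?_)
      rw [h, mul_add, add_left_comm, h2]
      generalize Fintype.card F - 1 = r at hk
      rw [hk]
      ring
    · refine Or.inr (Or.inr ?_)
      rw [h, mul_add, add_left_comm, h1]
      ring

/-- A set of points with the vectors over it invariant under translation by `V` is the cone with
vertex `V` over its section by a complement of `V`. -/
theorem eq_cone {K : Set (PGPoint F n)} {V T : Submodule F (Fin (n + 1) → F)} (hVT : IsCompl V T)
    (hV : V ≠ ⊥) (hVK : ∀ v ∈ V, v ∈ vectorsOver K)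
    (hadd : ∀ x ∈ vectorsOver K, ∀ v ∈ V, x + v ∈ vectorsOver K) :
    K = projSet F n V ∪ ⋃ y ∈ K ∩ projSet F n T, ⋃ x ∈ projSet F n V,
      projSet F n (x.submodule ⊔ y.submodule) := by
  have hmk : ∀ {v : Fin (n + 1) → F} {W : Submodule F (Fin (n + 1) → F)} (hv : v ≠ 0), v ∈ W →
      Projectivization.mk F v hv ∈ projSet F n W := fun {v W} hv h => by
    change (Projectivization.mk F v hv).submodule ≤ W
    rwa [Projectivization.submodule_mk, Submodule.span_singleton_le_iff_mem]
  have hself : ∀ {v : Fin (n + 1) → F} (hv : v ≠ 0),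
      v ∈ (Projectivization.mk F v hv).submodule := fun {v} hv => by
    rw [Projectivization.submodule_mk]
    exact Submodule.mem_span_singleton_self v
  ext z
  simp only [Set.mem_union, Set.mem_iUnion, exists_prop]
  constructor
  · intro hz
    obtain ⟨v, hv, t, ht, hvt⟩ := Submodule.mem_sup.1
      (show z.rep ∈ V ⊔ T from hVT.sup_eq_top ▸ Submodule.mem_top)
    by_cases ht0 : t = 0
    · left
      rw [mem_projSet_iff, ← hvt, ht0, add_zero]
      exact hv
    right
    have htK : t ∈ vectorsOver K := by
      have := hadd _ (rep_mem_vectorsOver.2 hz) _ (V.neg_mem hv)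
      rwa [← hvt, add_neg_cancel_comm] at this
    refine ⟨Projectivization.mk F t ht0, ⟨mk_mem_of_mem_vectorsOver htK ht0, hmk ht0 ht⟩, ?_⟩
    by_cases hv0 : v = 0
    · obtain ⟨w, hw, hw0⟩ := Submodule.exists_mem_ne_zero_of_ne_bot hV
      refine ⟨Projectivization.mk F w hw0, hmk hw0 hw, ?_⟩
      rw [mem_projSet_iff, ← hvt, hv0, zero_add]
      exact Submodule.mem_sup_right (hself ht0)
    · refine ⟨Projectivization.mk F v hv0, hmk hv0 hv, ?_⟩
      rw [mem_projSet_iff, ← hvt]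
      exact Submodule.add_mem_sup (hself hv0) (hself ht0)
  · rintro (hz | ⟨y, ⟨hyK, -⟩, x, hx, hz⟩)
    · exact rep_mem_vectorsOver.1 (hVK _ (mem_projSet_iff.1 hz))
    · obtain ⟨v, hv, w, hw, hvw⟩ := Submodule.mem_sup.1 (mem_projSet_iff.1 hz)
      rw [← rep_mem_vectorsOver, ← hvw, add_comm v w]
      exact hadd _ (mem_vectorsOver.2 (Or.inr ⟨y, hyK, hw⟩)) _ (hx hv)

end Projective

/-- In `PG(n,q)`, `n ≥ 5`, with `2 ≤ d ≤ q-1` and `gcd(d-1, q) = 1`,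
every plane blocking set of type
`(θ_{n-3}, q^{n-3}(qd+d-q) + θ_{n-4}, q^{n-2}d + θ_{n-3})_{n-1}` is a maximal arc cone:
there are an `(n-3)`-dimensional subspace `V ⊆ K` and a plane `τ` disjoint from `V`
such that `K ∩ τ` is a maximal arc of degree `d` in `τ` and `K` is the union of `V`
together with all points on lines joining a point of `V` to a point of `K ∩ τ`. -/
theorem statement12 [Fintype F] (q n d : ℕ) (hq : Fintype.card F = q) (hn : 5 ≤ n)
    (hd2 : 2 ≤ d) (hdq : d ≤ q - 1) (hgcd : Nat.gcd (d - 1) q = 1)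
    (K : Set (PGPoint F n)) (hblock : BlocksDim F n 2 K)
    (hK : IsType3 F n K (theta q (n - 3)) (q ^ (n - 3) * (q * d + d - q) + theta q (n - 4))
      (q ^ (n - 2) * d + theta q (n - 3))) :
    ∃ Wv Wt : Submodule F (Fin (n + 1) → F),
      finrank F Wv = n - 2 ∧ finrank F Wt = 3 ∧ Wv ⊓ Wt = ⊥ ∧
      projSet F n Wv ⊆ K ∧
      IsMaximalArc F n d Wt (K ∩ projSet F n Wt) ∧
      K = projSet F n Wv ∪
        ⋃ y ∈ K ∩ projSet F n Wt, ⋃ x ∈ projSet F n Wv,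
          projSet F n (x.submodule ⊔ y.submodule) := by
  classical
  subst hq
  obtain ⟨l, rfl⟩ : ∃ l, n = l + 4 := ⟨n - 4, by omega⟩
  obtain ⟨D, rfl⟩ : ∃ D, d = D + 1 := ⟨d - 1, by omega⟩
  have hq : 1 < Fintype.card F := Fintype.one_lt_card
  have hb : Fintype.card F * (D + 1) + (D + 1) - Fintype.card F =
      (Fintype.card F + 1) * D + 1 := by
    rw [mul_add, add_mul]
    omega
  obtain ⟨hall, ⟨W, hWr, hW⟩, -, -⟩ := hK
  rw [hb] at hall
  have hX : IsArcConeLike F (l + 1) D (vectorsOver K) :=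
    isArcConeLike_vectorsOver (by omega) (by omega) hgcd hblock hall
  obtain ⟨f, hf0, hf⟩ := exists_dual_ker_eq (W := W) (by rw [hWr, finrank_fin_fun])
  obtain ⟨V, hV⟩ := hX.exists_isVertex hf0 (by
    rw [kerCount_vectorsOver, hf, hW]
    exact one_add_sub_one_mul_theta hq (l + 1))
  obtain ⟨T, hVT⟩ := Submodule.exists_isCompl V
  have hT : finrank F T = 3 := by
    have := Submodule.finrank_add_eq_of_isCompl hVT
    rw [hV.finrank_eq, finrank_fin_fun] at this
    omega
  have hVK : ∀ v ∈ V, v ∈ vectorsOver K := fun v hv => ((hV.mem_iff v).1 hv).1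
  refine ⟨V, T, by rw [hV.finrank_eq]; omega, hT, hVT.inf_eq_bot,
    fun x hx => rep_mem_vectorsOver.1 (hVK _ (mem_projSet_iff.1 hx)),
    ⟨Set.inter_subset_right, hblock T hT, fun L hLT hL => ?_⟩,
    eq_cone hVT ?_ hVK fun x hx v hv => hX.add_mem_of_mem_vertex hV hx hv⟩
  · have hKL : K ∩ projSet F (l + 4) T ∩ projSet F (l + 4) L = K ∩ projSet F (l + 4) L := by
      have hsub : projSet F (l + 4) L ⊆ projSet F (l + 4) T := fun x hx => le_trans hx hLT
      rw [Set.inter_assoc, Set.inter_eq_right.2 hsub]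
    have hVL : V ⊓ L = ⊥ := (hVT.disjoint.mono_right hLT).eq_bot
    have hcard := hX.card_filter_of_disjoint hV hVL hL
    rw [card_vectorsOver_filter] at hcard
    rw [hKL]
    have hr : 0 < Fintype.card F - 1 := by omega
    rcases hcard with h | h
    · left
      exact (Nat.mul_eq_zero.1 (Nat.add_left_cancel (h.trans (add_zero 1).symm))).resolve_left
        hr.ne'
    · right
      exact Nat.eq_of_mul_eq_mul_left hr (Nat.add_left_cancel h)
  · rintro rfl
    have := hV.finrank_eq
    rw [finrank_bot] at this
    omega
end
end

section
/- In PG(n,q), with n ≥ 4 and q a square prime power, let K be an (n−1)-blocking set of type (a,b,c)_{n-1} with a = θ_{n-2}, b = θ_{n-3} + (√q)^{2n−3} and c = θ_{n-2} + (√q)^{2n−3}. Then k = θ_{n-2} + (√q)^{2n−1}, t_a = (√q)³ + 1, t_b = θ_n − θ_2 and t_c = q² − (√q)³ + q. -/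
open Module Set

noncomputable section

variable (F : Type) [Field F]

/-- The intersection numbers `N₂`, `r + Q s`, `N₂ + Q s` written as `k - Q u`: the multiplicities of
the three values of `u` satisfy the two power-sum identities. -/
theorem weight_moments {s Q r N₀ N₁ N₂ k m ta tb tc : ℤ} (hs : 2 ≤ s) (hQ : s ^ 4 ≤ Q)
    (hr : (s ^ 2 - 1) * r = Q - 1) (hN₂ : (s ^ 2 - 1) * N₂ = Q * s ^ 2 - 1)
    (hN₁ : (s ^ 2 - 1) * N₁ = Q * s ^ 4 - 1) (hN₀ : (s ^ 2 - 1) * N₀ = Q * s ^ 6 - 1)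
    (h₀ : ta + tb + tc = N₀)
    (h₁ : N₂ * ta + (r + Q * s) * tb + (N₂ + Q * s) * tc = k * N₁)
    (h₂ : N₂ ^ 2 * ta + (r + Q * s) ^ 2 * tb + (N₂ + Q * s) ^ 2 * tc =
      k * N₁ + k * (k - 1) * N₂)
    (hk : k = N₂ + Q * m) :
    m * ta + (m - s + 1) * tb + (m - s) * tc = k * s ^ 4 ∧
    m ^ 2 * ta + (m - s + 1) ^ 2 * tb + (m - s) ^ 2 * tc =
      k * s ^ 2 * (s ^ 2 + m * (s ^ 2 - 1)) := by
  have hD : s ^ 2 - 1 ≠ 0 := by nlinarith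
  have hQ0 : Q ≠ 0 := ((by positivity : 0 < s ^ 4).trans_le hQ).ne'
  have hrN : r = N₂ - Q := mul_left_cancel₀ hD (by linear_combination hr - hN₂)
  have h12 : N₁ - N₂ = Q * s ^ 2 := mul_left_cancel₀ hD (by linear_combination hN₁ - hN₂)
  have h01 : N₀ - N₁ = Q * s ^ 4 := mul_left_cancel₀ hD (by linear_combination hN₀ - hN₁)
  have e₁ : Q * (m * ta + (m - s + 1) * tb + (m - s) * tc) = Q * (k * s ^ 4) := by
    have hA : Q * (m * ta + (m - s + 1) * tb + (m - s) * tc) = k * N₀ - k * N₁ := by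
      rw [← h₁, ← h₀, hrN, hk]; ring
    rw [hA]; linear_combination k * h01
  have e₂ : Q ^ 2 * (m ^ 2 * ta + (m - s + 1) ^ 2 * tb + (m - s) ^ 2 * tc) =
      Q ^ 2 * (k * s ^ 2 * (s ^ 2 + m * (s ^ 2 - 1))) := by
    have hA : Q ^ 2 * (m ^ 2 * ta + (m - s + 1) ^ 2 * tb + (m - s) ^ 2 * tc) =
        k ^ 2 * N₀ - 2 * k * (k * N₁) + (k * N₁ + k * (k - 1) * N₂) := by
      rw [← h₂, ← h₁, ← h₀, hrN, hk]; ring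
    have hkD : k * (s ^ 2 - 1) + 1 = Q * (s ^ 2 + m * (s ^ 2 - 1)) := by
      rw [hk]; linear_combination hN₂
    rw [hA]
    linear_combination k ^ 2 * h01 - (k ^ 2 - k) * h12 + k * Q * s ^ 2 * hkD
  exact ⟨mul_left_cancel₀ hQ0 e₁, mul_left_cancel₀ (pow_ne_zero 2 hQ0) e₂⟩

/-- Nonnegativity of the three multiplicities forces `m = s ^ 3`. -/
theorem eq_cube_of_multiplicities_nonneg {s Q m ta tb tc : ℤ} (hs : 2 ≤ s) (hQ : s ^ 4 ≤ Q)
    (hm : 0 ≤ m) (hm' : m < s ^ 3 + s ^ 2) (hta : 0 ≤ ta) (htb : 0 ≤ tb) (htc : 0 ≤ tc)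
    (ea : ta * (s * (s - 1) * (s ^ 2 - 1)) = Q * (s ^ 2 * ((s ^ 3 - m) * (s ^ 3 + s ^ 2 - m))) +
      (m * (s ^ 4 + s ^ 2) - 2 * s ^ 5 - (m - s) * (m - s + 1)))
    (eb : tb * ((s - 1) * (s ^ 2 - 1)) =
      -(Q * (s ^ 2 * ((s ^ 2 - m) * (s ^ 3 + s ^ 2 - m))) +
        (m * (s ^ 4 + s ^ 2 + s - m) - s ^ 4 * (1 + s))))
    (ec : tc * (s * (s ^ 2 - 1)) = -(Q * (s ^ 2 * ((m - s ^ 2) * (s ^ 3 - m)))) +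
      (m * (s ^ 4 + s ^ 2 + s - 1 - m) - s ^ 5)) :
    m = s ^ 3 := by
  have hD : 0 < s ^ 2 - 1 := by nlinarith
  have hs1 : 0 < s - 1 := by linarith
  have hs0 : 0 < s := by linarith
  have pa := mul_nonneg hta (by positivity : 0 ≤ s * (s - 1) * (s ^ 2 - 1))
  have pb := mul_nonneg htb (by positivity : 0 ≤ (s - 1) * (s ^ 2 - 1))
  have pc := mul_nonneg htc (by positivity : 0 ≤ s * (s ^ 2 - 1))
  have hs2 : 2 * s ≤ s ^ 2 := by nlinarith
  have hs3 : 2 * s ^ 2 ≤ s ^ 3 := by rw [pow_succ s 2]; nlinarith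
  have hs4 : 2 * s ^ 3 ≤ s ^ 4 := by rw [pow_succ s 3]; nlinarith [pow_pos hs0 3]
  have hs46 : s ^ 4 < s ^ 6 := pow_lt_pow_right₀ (by linarith) (by norm_num)
  have hs59 : s ^ 5 < s ^ 9 := pow_lt_pow_right₀ (by linarith) (by norm_num)
  have key : ∀ x y : ℤ, 0 ≤ y → y ≤ x → s ^ 6 * y ≤ Q * (s ^ 2 * x) := fun x y hy hx => by
    have hx0 : 0 ≤ x := hy.trans hx
    calc s ^ 6 * y ≤ s ^ 6 * x := by gcongr
      _ = s ^ 4 * (s ^ 2 * x) := by ring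
      _ ≤ Q * (s ^ 2 * x) := by gcongr
  rcases lt_trichotomy m (s ^ 3) with h | h | h
  · exfalso
    rcases lt_trichotomy m (s ^ 2) with h' | h' | h'
    · have hx : 1 * (s ^ 3 + 1) ≤ (s ^ 2 - m) * (s ^ 3 + s ^ 2 - m) :=
        mul_le_mul (by linarith) (by linarith) (by linarith) (by linarith)
      have h1 := key _ _ (by linarith) hx
      have h2 : 0 ≤ m * (s ^ 4 + s ^ 2 + s - m) := mul_nonneg hm (by linarith)
      linarith
    · have h1 : tb * ((s - 1) * (s ^ 2 - 1)) = -(s ^ 3 * ((s - 1) * (s ^ 2 - 1))) := by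
        rw [eb, h']; ring
      have h2 : 0 < s ^ 3 * ((s - 1) * (s ^ 2 - 1)) := by positivity
      linarith
    · have hx : s ^ 3 - s ^ 2 - 1 ≤ (m - s ^ 2) * (s ^ 3 - m) := by
        linarith [mul_nonneg (by linarith : 0 ≤ m - s ^ 2 - 1) (by linarith : 0 ≤ s ^ 3 - m - 1)]
      have h1 := key (x := (m - s ^ 2) * (s ^ 3 - m)) (s + 1) (by linarith) (by linarith)
      have h2 : m * (s ^ 4 + s ^ 2 + s - 1 - m) ≤ s ^ 3 * (s ^ 4 + s ^ 2 + s - 1) :=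
        mul_le_mul h.le (by linarith) (by linarith) (by linarith)
      linarith
  · exact h
  · exfalso
    have hx : s ^ 2 - 1 ≤ (m - s ^ 3) * (s ^ 3 + s ^ 2 - m) := by
      linarith [mul_nonneg (by linarith : 0 ≤ m - s ^ 3 - 1)
        (by linarith : 0 ≤ s ^ 3 + s ^ 2 - m - 1)]
    have h1 := key _ _ (by linarith) hx
    have h2 : 0 ≤ (m - s) * (m - s + 1) := mul_nonneg (by linarith) (by linarith)
    have h3 : m * (s ^ 4 + s ^ 2) ≤ (s ^ 3 + s ^ 2) * (s ^ 4 + s ^ 2) := by gcongr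
    have h4 : 0 < s ^ 4 * (s ^ 4 - s ^ 3 - 2 * s ^ 2 + s - 1) :=
      mul_pos (by positivity) (by linarith)
    linarith

/-- The values of the multiplicities, and of `k` through `m`. -/
theorem multiplicities_eq {s Q r N₀ N₁ N₂ k m ta tb tc : ℤ} (hs : 2 ≤ s) (hQ : s ^ 4 ≤ Q)
    (hr : (s ^ 2 - 1) * r = Q - 1) (hN₂ : (s ^ 2 - 1) * N₂ = Q * s ^ 2 - 1)
    (hN₁ : (s ^ 2 - 1) * N₁ = Q * s ^ 4 - 1) (hN₀ : (s ^ 2 - 1) * N₀ = Q * s ^ 6 - 1)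
    (hta : 0 ≤ ta) (htb : 0 ≤ tb) (htc : 0 ≤ tc)
    (h₀ : ta + tb + tc = N₀)
    (h₁ : N₂ * ta + (r + Q * s) * tb + (N₂ + Q * s) * tc = k * N₁)
    (h₂ : N₂ ^ 2 * ta + (r + Q * s) ^ 2 * tb + (N₂ + Q * s) ^ 2 * tc =
      k * N₁ + k * (k - 1) * N₂)
    (hk : k = N₂ + Q * m) (hm : 0 ≤ m) (hm' : m < s ^ 3 + s ^ 2) :
    m = s ^ 3 ∧ ta = s ^ 3 + 1 ∧ tc = s ^ 4 - s ^ 3 + s ^ 2 := by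
  obtain ⟨e₁, e₂⟩ := weight_moments hs hQ hr hN₂ hN₁ hN₀ h₀ h₁ h₂ hk
  have hkD : k * (s ^ 2 - 1) = Q * (s ^ 2 + m * (s ^ 2 - 1)) - 1 := by
    rw [hk]; linear_combination hN₂
  have h₀' : (s ^ 2 - 1) * (ta + tb + tc) = Q * s ^ 6 - 1 := by rw [h₀, hN₀]
  have ea : ta * (s * (s - 1) * (s ^ 2 - 1)) =
      Q * (s ^ 2 * ((s ^ 3 - m) * (s ^ 3 + s ^ 2 - m))) +
      (m * (s ^ 4 + s ^ 2) - 2 * s ^ 5 - (m - s) * (m - s + 1)) := by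
    linear_combination (s ^ 2 - 1) * e₂ - (s ^ 2 - 1) * (2 * m - 2 * s + 1) * e₁ +
      (m - s) * (m - s + 1) * h₀' +
      (s ^ 2 * (s ^ 2 + m * (s ^ 2 - 1)) - (2 * m - 2 * s + 1) * s ^ 4) * hkD
  have eb : tb * ((s - 1) * (s ^ 2 - 1)) =
      -(Q * (s ^ 2 * ((s ^ 2 - m) * (s ^ 3 + s ^ 2 - m))) +
        (m * (s ^ 4 + s ^ 2 + s - m) - s ^ 4 * (1 + s))) := by
    linear_combination -(s ^ 2 - 1) * e₂ + (s ^ 2 - 1) * (2 * m - s) * e₁ -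
      m * (m - s) * h₀' -
      (s ^ 2 * (s ^ 2 + m * (s ^ 2 - 1)) - (2 * m - s) * s ^ 4) * hkD
  have ec : tc * (s * (s ^ 2 - 1)) = -(Q * (s ^ 2 * ((m - s ^ 2) * (s ^ 3 - m)))) +
      (m * (s ^ 4 + s ^ 2 + s - 1 - m) - s ^ 5) := by
    linear_combination (s ^ 2 - 1) * e₂ - (s ^ 2 - 1) * (2 * m - s + 1) * e₁ +
      m * (m - s + 1) * h₀' +
      (s ^ 2 * (s ^ 2 + m * (s ^ 2 - 1)) - (2 * m - s + 1) * s ^ 4) * hkD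
  have hms := eq_cube_of_multiplicities_nonneg hs hQ hm hm' hta htb htc ea eb ec
  have hD : 0 < s ^ 2 - 1 := by nlinarith
  have hs1 : 0 < s - 1 := by linarith
  refine ⟨hms, mul_right_cancel₀ (b := s * (s - 1) * (s ^ 2 - 1)) (by positivity) ?_,
    mul_right_cancel₀ (b := s * (s ^ 2 - 1)) (by positivity) ?_⟩
  · rw [ea, hms]; ring
  · rw [ec, hms]; ring

/-- The size of `K` is congruent to `N₂` modulo `Q`, and bounded in terms of a hyperplane meeting
`K` in `N₂` points. -/
theorem exists_eq_add_mul {s Q r N₀ N₁ N₂ k ta tb tc : ℤ} (hs : 2 ≤ s) (hQ : 0 < Q)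
    (hcop : IsCoprime Q (s ^ 2 - 1))
    (hr : (s ^ 2 - 1) * r = Q - 1) (hN₂ : (s ^ 2 - 1) * N₂ = Q * s ^ 2 - 1)
    (hN₁ : (s ^ 2 - 1) * N₁ = Q * s ^ 4 - 1) (hN₀ : (s ^ 2 - 1) * N₀ = Q * s ^ 6 - 1)
    (h₀ : ta + tb + tc = N₀)
    (h₁ : N₂ * ta + (r + Q * s) * tb + (N₂ + Q * s) * tc = k * N₁)
    (hk : N₂ ≤ k)
    (hle : (N₂ + Q * s - N₂) * N₂ ≤
      (N₂ + Q * s) * (N₂ * N₁) - (k * N₂ * N₂ + N₂ * (N₁ - N₂))) :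
    ∃ m, k = N₂ + Q * m ∧ 0 ≤ m ∧ m < s ^ 3 + s ^ 2 := by
  have hq : 4 ≤ s ^ 2 := by nlinarith
  have hD : 0 < s ^ 2 - 1 := by linarith
  have hrN : r = N₂ - Q := mul_left_cancel₀ hD.ne' (by linear_combination hr - hN₂)
  have h12 : N₁ = s ^ 2 * N₂ + 1 :=
    mul_left_cancel₀ hD.ne' (by linear_combination hN₁ - s ^ 2 * hN₂)
  have hdvd : Q ∣ (s ^ 2 - 1) * (k - N₂) := by
    refine ⟨k * (s ^ 2 - 1) * s ^ 4 - (s ^ 2 - 1) ^ 2 * (s * tb - tb + s * tc) -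
      (Q * s ^ 8 - s ^ 2 - s ^ 6) - s ^ 2, ?_⟩
    have h : N₂ * N₀ + Q * (s * tb - tb + s * tc) = k * N₁ := by
      rw [← h₁, ← h₀, hrN]; ring
    linear_combination (s ^ 2 - 1) ^ 2 * h - (s ^ 2 - 1) * N₀ * hN₂ -
      (Q * s ^ 2 - 1) * hN₀ + k * (s ^ 2 - 1) * hN₁ - hN₂
  obtain ⟨m, hm⟩ := hcop.dvd_of_dvd_mul_left hdvd
  refine ⟨m, by linear_combination hm, nonneg_of_mul_nonneg_right (by linarith) hQ, ?_⟩
  have hN₂0 : 0 < N₂ := pos_of_mul_pos_right (a := s ^ 2 - 1) (by nlinarith) hD.le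
  have hkm : k = N₂ + Q * m := by linear_combination hm
  have hlt : Q * m < Q * (s ^ 3 + s ^ 2) := by
    rw [h12, hkm] at hle
    have h : N₂ * (Q * m * N₂) ≤
        N₂ * (N₂ * (s ^ 2 * N₂ + Q * s ^ 3 - N₂ - s ^ 2 + 2) - 1) := by linarith
    have h' := le_of_mul_le_mul_left h hN₂0
    have h'' : N₂ * (Q * m) < N₂ * (s ^ 2 * N₂ + Q * s ^ 3 - N₂ - s ^ 2 + 2) := by linarith
    linarith [lt_of_mul_lt_mul_left h'' hN₂0.le]
  exact lt_of_mul_lt_mul_left hlt hQ.le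

variable {F}

/-- The dual of a finite vector space over a finite field is finite. -/
instance [Fintype F] (n : ℕ) : Fintype (Dual F (Fin (n + 1) → F)) :=
  @Fintype.ofFinite _ (Module.finite_of_finite F)

theorem theta_mul {q : ℕ} (hq : 2 ≤ q) (m : ℕ) :
    ((q : ℤ) - 1) * theta q m = (q : ℤ) ^ (m + 1) - 1 := by
  have hd : q - 1 ∣ q ^ (m + 1) - 1 := by
    simpa using Nat.sub_dvd_pow_sub_pow q 1 (m + 1)
  have h := Nat.mul_div_cancel' hd
  have h1 : 1 ≤ q ^ (m + 1) := Nat.one_le_pow _ _ (by omega)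
  have h' := congrArg (Nat.cast : ℕ → ℤ) h
  rw [Nat.cast_mul, Nat.cast_sub (by omega), Nat.cast_sub h1] at h'
  exact_mod_cast h'

open Classical in
/-- The hyperplanes of `PG(n,q)`. -/
def hyperplanes (F : Type) [Field F] [Fintype F] (n : ℕ) :
    Finset (Submodule F (Fin (n + 1) → F)) :=
  Finset.univ.filter fun W => finrank F W = n

theorem mem_hyperplanes [Fintype F] {n : ℕ} {W : Submodule F (Fin (n + 1) → F)} :
    W ∈ hyperplanes F n ↔ finrank F W = n := by
  simp [hyperplanes]

open Classical in
theorem card_dualAnnihilator_ne_zero [Fintype F] {n d : ℕ} {U : Submodule F (Fin (n + 1) → F)}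
    (hU : finrank F U + d = n + 1) :
    (Finset.univ.filter fun f : Dual F (Fin (n + 1) → F) =>
      f ∈ U.dualAnnihilator ∧ f ≠ 0).card = Fintype.card F ^ d - 1 := by
  have hd : finrank F U.dualAnnihilator = d := by
    have := Subspace.finrank_add_finrank_dualAnnihilator_eq U
    simp only [finrank_fintype_fun_eq_card, Fintype.card_fin] at this
    omega
  have hc : (Finset.univ.filter fun f : Dual F (Fin (n + 1) → F) =>
      f ∈ U.dualAnnihilator).card = Fintype.card F ^ d := by
    rw [← hd, ← Module.card_eq_pow_finrank (K := F) (V := U.dualAnnihilator),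
      Fintype.card_subtype]
  rw [← hc, Finset.filter_and_not, ← Finset.card_erase_of_mem (a := 0) (by simp)]
  congr 1
  ext f
  simp [and_comm]

open Classical in
/-- Counting hyperplanes through a subspace of codimension `d + 1`. -/
theorem card_hyperplanes_filter_le [Fintype F] {n d : ℕ} {U : Submodule F (Fin (n + 1) → F)}
    (hU : finrank F U + (d + 1) = n + 1) :
    ((hyperplanes F n).filter (U ≤ ·)).card = theta (Fintype.card F) d := by
  have hq : 1 < Fintype.card F := Fintype.one_lt_card
  have hker : ∀ f : Dual F (Fin (n + 1) → F), f ≠ 0 → finrank F (LinearMap.ker f) = n := by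
    intro f hf
    have := Dual.finrank_ker_add_one_of_ne_zero hf
    simp only [finrank_fintype_fun_eq_card, Fintype.card_fin] at this
    omega
  have hle : ∀ (W : Submodule F (Fin (n + 1) → F)) (f : Dual F (Fin (n + 1) → F)),
      f ∈ W.dualAnnihilator ↔ W ≤ LinearMap.ker f := fun W f => by
    rw [Submodule.mem_dualAnnihilator]; rfl
  have hfib := Finset.card_eq_sum_card_fiberwise
    (f := fun f : Dual F (Fin (n + 1) → F) => LinearMap.ker f)
    (s := Finset.univ.filter fun f => f ∈ U.dualAnnihilator ∧ f ≠ 0)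
    (t := (hyperplanes F n).filter (U ≤ ·)) (by
      intro f hf
      simp only [Finset.coe_filter, Finset.mem_univ, true_and, Set.mem_ofPred_eq, hle] at hf
      simp [mem_hyperplanes, hker f hf.2, hf.1])
  rw [card_dualAnnihilator_ne_zero hU, Finset.sum_congr rfl (g := fun _ => Fintype.card F - 1),
    Finset.sum_const, smul_eq_mul] at hfib
  · rw [theta, hfib, Nat.mul_div_cancel _ (by omega)]
  · intro W hW
    rw [Finset.mem_filter, mem_hyperplanes] at hW
    rw [← pow_one (Fintype.card F),
      ← card_dualAnnihilator_ne_zero (U := W) (d := 1) (by rw [hW.1]), Finset.filter_filter]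
    congr 1
    ext f
    simp only [Finset.mem_filter, Finset.mem_univ, true_and, hle]
    constructor
    · rintro ⟨⟨-, h0⟩, rfl⟩
      exact ⟨le_rfl, h0⟩
    · rintro ⟨h, h0⟩
      exact ⟨⟨hW.2.trans h, h0⟩,
        (Submodule.eq_of_le_of_finrank_eq h (by rw [hW.1, hker f h0])).symm⟩

theorem finrank_submodule_sup {n : ℕ} {x y : PGPoint F n} (h : x ≠ y) :
    finrank F (x.submodule ⊔ y.submodule : Submodule F (Fin (n + 1) → F)) = 2 := by
  have h1 := Submodule.finrank_sup_add_finrank_inf_eq x.submodule y.submodule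
  rw [x.finrank_submodule, y.finrank_submodule] at h1
  have h0 : finrank F (x.submodule ⊓ y.submodule : Submodule F (Fin (n + 1) → F)) = 0 := by
    by_contra hne
    have hx := Submodule.eq_of_le_of_finrank_le (inf_le_left : x.submodule ⊓ y.submodule ≤ _)
      (by rw [x.finrank_submodule]; omega)
    have hy := Submodule.eq_of_le_of_finrank_le (inf_le_right : x.submodule ⊓ y.submodule ≤ _)
      (by rw [y.finrank_submodule]; omega)
    exact h (Projectivization.submodule_injective (hx.symm.trans hy))
  omega

theorem le_iff_mem_projSet {n : ℕ} {W : Submodule F (Fin (n + 1) → F)} {x : PGPoint F n} :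
    x.submodule ≤ W ↔ x ∈ projSet F n W := Iff.rfl

open Classical in
/-- The number of hyperplanes through two, possibly equal, points. -/
theorem card_hyperplanes_through_pair [Fintype F] {n : ℕ} (hn : 2 ≤ n) (x y : PGPoint F n) :
    (((hyperplanes F n).filter fun W => x ∈ projSet F n W ∧ y ∈ projSet F n W).card : ℤ) =
      theta (Fintype.card F) (n - 2) + if x = y then
        (theta (Fintype.card F) (n - 1) : ℤ) - theta (Fintype.card F) (n - 2) else 0 := by
  split_ifs with h
  · subst h
    simp only [and_self, ← le_iff_mem_projSet]
    rw [card_hyperplanes_filter_le (d := n - 1) (by rw [x.finrank_submodule]; omega)]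
    ring
  · simp only [← le_iff_mem_projSet, ← sup_le_iff]
    rw [card_hyperplanes_filter_le (d := n - 2) (by rw [finrank_submodule_sup h]; omega)]
    ring

theorem card_hyperplanes [Fintype F] (n : ℕ) :
    (hyperplanes F n).card = theta (Fintype.card F) n := by
  classical
  rw [← card_hyperplanes_filter_le (U := (⊥ : Submodule F (Fin (n + 1) → F))) (d := n) (by simp)]
  simp

/-- Counting triples of a hyperplane, a point of `A` on it and a point of `B` on it. -/
theorem sum_ncard_mul_ncard [Fintype F] {n : ℕ} (hn : 2 ≤ n) (A B : Set (PGPoint F n)) :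
    ∑ W ∈ hyperplanes F n, ((A ∩ projSet F n W).ncard : ℤ) * (B ∩ projSet F n W).ncard =
      A.ncard * B.ncard * theta (Fintype.card F) (n - 2) + (A ∩ B).ncard *
        ((theta (Fintype.card F) (n - 1) : ℤ) - theta (Fintype.card F) (n - 2)) := by
  classical
  have : Fintype (PGPoint F n) := Fintype.ofFinite _
  have hcard : ∀ C : Set (PGPoint F n), (C.ncard : ℤ) = ∑ x, if x ∈ C then 1 else 0 := fun C => by
    rw [Set.ncard_eq_toFinset_card', Finset.sum_boole, Set.filter_mem_univ_eq_toFinset]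
  simp only [hcard, Finset.sum_mul]
  rw [Finset.sum_comm, ← Finset.sum_add_distrib]
  refine Finset.sum_congr rfl fun x _ => ?_
  simp only [Finset.mul_sum]
  rw [Finset.sum_comm]
  trans ∑ y, ((if x ∈ A then 1 else 0) * (if y ∈ B then 1 else 0)) *
    ((theta (Fintype.card F) (n - 2) : ℤ) + if x = y then
        (theta (Fintype.card F) (n - 1) : ℤ) - theta (Fintype.card F) (n - 2) else 0)
  · refine Finset.sum_congr rfl fun y _ => ?_
    rw [← card_hyperplanes_through_pair hn, Finset.card_filter]
    push_cast
    rw [Finset.mul_sum]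
    refine Finset.sum_congr rfl fun W _ => ?_
    by_cases hxA : x ∈ A <;> by_cases hyB : y ∈ B <;> by_cases hx : x ∈ projSet F n W <;>
      by_cases hy : y ∈ projSet F n W <;> simp [hxA, hyB, hx, hy]
  · simp only [mul_add, Finset.sum_add_distrib, Finset.sum_mul, mul_ite, mul_zero, Finset.sum_ite_eq,
      Finset.mem_univ, if_true]
    by_cases hxA : x ∈ A <;> by_cases hxB : x ∈ B <;> simp [hxA, hxB]

/-- Counting incident pairs of a point of `A` and a hyperplane. -/
theorem sum_ncard_inter [Fintype F] {n : ℕ} (hn : 2 ≤ n) (A : Set (PGPoint F n)) :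
    ∑ W ∈ hyperplanes F n, ((A ∩ projSet F n W).ncard : ℤ) =
      A.ncard * theta (Fintype.card F) (n - 1) := by
  classical
  have : Fintype (PGPoint F n) := Fintype.ofFinite _
  have hcard : ∀ C : Set (PGPoint F n), (C.ncard : ℤ) = ∑ x, if x ∈ C then 1 else 0 := fun C => by
    rw [Set.ncard_eq_toFinset_card', Finset.sum_boole, Set.filter_mem_univ_eq_toFinset]
  simp only [hcard, Finset.sum_mul]
  rw [Finset.sum_comm]
  refine Finset.sum_congr rfl fun x _ => ?_
  have hx := card_hyperplanes_through_pair hn x x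
  rw [if_pos rfl, add_sub_cancel, Finset.card_filter] at hx
  rw [← hx]
  push_cast
  rw [Finset.mul_sum]
  refine Finset.sum_congr rfl fun W _ => ?_
  by_cases hxA : x ∈ A <;> by_cases hx : x ∈ projSet F n W <;> simp [hxA, hx]

open Classical in
theorem tnum_eq_card_filter [Fintype F] {n : ℕ} (K : Set (PGPoint F n)) (m : ℕ) :
    tnum F n K m = ((hyperplanes F n).filter fun W => (K ∩ projSet F n W).ncard = m).card := by
  rw [tnum, ← Set.ncard_coe_finset]
  congr 1
  ext W
  simp [mem_hyperplanes]

theorem IsType3.sum_eq [Fintype F] {n a b c : ℕ} {K : Set (PGPoint F n)}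
    (hK : IsType3 F n K a b c) (hab : a ≠ b) (hac : a ≠ c) (hbc : b ≠ c) (g : ℕ → ℤ) :
    ∑ W ∈ hyperplanes F n, g (K ∩ projSet F n W).ncard =
      g a * tnum F n K a + g b * tnum F n K b + g c * tnum F n K c := by
  classical
  simp only [tnum_eq_card_filter, Finset.card_filter]
  push_cast
  rw [Finset.mul_sum, Finset.mul_sum, Finset.mul_sum, ← Finset.sum_add_distrib,
    ← Finset.sum_add_distrib]
  refine Finset.sum_congr rfl fun W hW => ?_
  rcases hK.1 W (mem_hyperplanes.1 hW) with h | h | h <;>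
    simp [h, hab, hac, hbc, hab.symm, hac.symm, hbc.symm]

/-- A bound on `K` from the hyperplane `H`, when no hyperplane meets `K` in more than `c` points. -/
theorem sub_mul_ncard_le [Fintype F] {n c : ℕ} (hn : 2 ≤ n) {K : Set (PGPoint F n)}
    (hc : ∀ W ∈ hyperplanes F n, (K ∩ projSet F n W).ncard ≤ c)
    {H : Submodule F (Fin (n + 1) → F)} (hH : finrank F H = n) :
    ((c : ℤ) - (K ∩ projSet F n H).ncard) * (K ∩ projSet F n H).ncard ≤
      c * ((K ∩ projSet F n H).ncard * theta (Fintype.card F) (n - 1)) -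
        (K.ncard * (K ∩ projSet F n H).ncard * theta (Fintype.card F) (n - 2) +
          (K ∩ projSet F n H).ncard *
            ((theta (Fintype.card F) (n - 1) : ℤ) - theta (Fintype.card F) (n - 2))) := by
  have h₁ := sum_ncard_inter hn (K ∩ projSet F n H)
  have h₂ := sum_ncard_mul_ncard hn K (K ∩ projSet F n H)
  rw [← Set.inter_assoc, Set.inter_self] at h₂
  rw [← h₁, ← h₂, Finset.mul_sum, ← Finset.sum_sub_distrib]
  simp only [← sub_mul]
  have := Finset.single_le_sum (s := hyperplanes F n)
    (f := fun W => ((c : ℤ) - (K ∩ projSet F n W).ncard) *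
      ((K ∩ projSet F n H) ∩ projSet F n W).ncard)
    (fun W hW => mul_nonneg (by simpa using hc W hW) (by positivity)) (mem_hyperplanes.2 hH)
  simpa [Set.inter_assoc] using this

variable (F)

/-- In `PG(n,q)`, `n ≥ 4`, `q` a square prime power, if `K` is an
`(n-1)`-blocking set of type `(θ_{n-2}, θ_{n-3} + √q^{2n-3}, θ_{n-2} + √q^{2n-3})_{n-1}`,
then `k = θ_{n-2} + √q^{2n-1}`, `t_a = √q³ + 1`, `t_b = θ_n - θ_2` and
`t_c = q² - √q³ + q`. -/
theorem statement15 [Fintype F] (p e q sq n : ℕ) (hp : p.Prime) (he : 0 < e)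
    (hqdef : q = p ^ (2 * e)) (hsq : sq = p ^ e) (hq : Fintype.card F = q)
    (hn : 4 ≤ n)
    (K : Set (PGPoint F n)) (hblock : BlocksDim F n 1 K)
    (hK : IsType3 F n K (theta q (n - 2)) (theta q (n - 3) + sq ^ (2 * n - 3))
      (theta q (n - 2) + sq ^ (2 * n - 3))) :
    K.ncard = theta q (n - 2) + sq ^ (2 * n - 1) ∧
    tnum F n K (theta q (n - 2)) = sq ^ 3 + 1 ∧
    tnum F n K (theta q (n - 3) + sq ^ (2 * n - 3)) = theta q n - theta q 2 ∧
    tnum F n K (theta q (n - 2) + sq ^ (2 * n - 3)) = q ^ 2 - sq ^ 3 + q := by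
  subst hsq
  have hqs : q = (p ^ e) ^ 2 := by rw [hqdef, ← pow_mul, mul_comm]
  obtain ⟨s, hs⟩ : ∃ s, s = p ^ e := ⟨_, rfl⟩
  rw [← hs] at hK hqs ⊢
  obtain ⟨j, rfl⟩ : ∃ j, n = j + 4 := ⟨n - 4, by omega⟩
  have hs2 : 2 ≤ s := hs ▸ hp.two_le.trans (Nat.le_self_pow he.ne' p)
  have hq2 : 2 ≤ q := hqs ▸ hs2.trans (Nat.le_self_pow two_ne_zero s)
  simp only [show j + 4 - 2 = j + 2 from rfl, show j + 4 - 3 = j + 1 from rfl,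
    show 2 * (j + 4) - 3 = 2 * j + 5 by omega, show 2 * (j + 4) - 1 = 2 * j + 7 by omega]
    at hK ⊢
  have hθ (i : ℕ) : ((s : ℤ) ^ 2 - 1) * theta q i = ((s : ℤ) ^ 2) ^ (i + 1) - 1 := by
    have h := theta_mul hq2 i
    rwa [hqs, Nat.cast_pow, ← hqs] at h
  obtain ⟨Q, hQ⟩ : ∃ Q : ℤ, Q = ((s : ℤ) ^ 2) ^ (j + 2) := ⟨_, rfl⟩
  have hsZ : (2 : ℤ) ≤ s := by exact_mod_cast hs2
  have hD : (0 : ℤ) < (s : ℤ) ^ 2 - 1 := by nlinarith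
  have hQ4 : (s : ℤ) ^ 4 ≤ Q := by
    rw [hQ, ← pow_mul]; exact pow_le_pow_right₀ (by linarith) (by omega)
  have hQ0 : 0 < Q := lt_of_lt_of_le (by positivity) hQ4
  have hr : ((s : ℤ) ^ 2 - 1) * theta q (j + 1) = Q - 1 := by rw [hθ, hQ]
  have hN₂ : ((s : ℤ) ^ 2 - 1) * theta q (j + 2) = Q * s ^ 2 - 1 := by rw [hθ, hQ]; ring
  have hN₁ : ((s : ℤ) ^ 2 - 1) * theta q (j + 3) = Q * s ^ 4 - 1 := by rw [hθ, hQ]; ring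
  have hN₀ : ((s : ℤ) ^ 2 - 1) * theta q (j + 4) = Q * s ^ 6 - 1 := by rw [hθ, hQ]; ring
  have hrN : (theta q (j + 1) : ℤ) = theta q (j + 2) - Q :=
    mul_left_cancel₀ hD.ne' (by linear_combination hr - hN₂)
  have hQs : ((s ^ (2 * j + 5) : ℕ) : ℤ) = Q * s := by rw [hQ]; push_cast; ring
  have hQs0 : 0 < Q * s := by positivity
  obtain ⟨a, ha⟩ : ∃ a, a = theta q (j + 2) := ⟨_, rfl⟩
  obtain ⟨b, hb⟩ : ∃ b, b = theta q (j + 1) + s ^ (2 * j + 5) := ⟨_, rfl⟩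
  obtain ⟨c, hc⟩ : ∃ c, c = theta q (j + 2) + s ^ (2 * j + 5) := ⟨_, rfl⟩
  rw [← hc, ← hb, ← ha] at hK ⊢
  have haZ : (a : ℤ) = theta q (j + 2) := by rw [ha]
  have hbZ : (b : ℤ) = theta q (j + 1) + Q * s := by rw [hb, Nat.cast_add, hQs]
  have hcZ : (c : ℤ) = theta q (j + 2) + Q * s := by rw [hc, Nat.cast_add, hQs]
  have hQQs : 2 * Q ≤ Q * s := by nlinarith
  have hab : a < b := by zify; linarith
  have hbc : b < c := by zify; linarith
  have hsum := hK.sum_eq hab.ne (hab.trans hbc).ne hbc.ne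
  have h₀ := hsum fun _ => 1
  have h₁ := hsum fun x => x
  have h₂ := hsum fun x => (x : ℤ) * x
  rw [sum_ncard_inter (by omega), hq, haZ, hbZ, hcZ, show j + 4 - 1 = j + 3 from rfl] at h₁
  rw [sum_ncard_mul_ncard (by omega), hq, Set.inter_self, haZ, hbZ, hcZ,
    show j + 4 - 1 = j + 3 from rfl, show j + 4 - 2 = j + 2 from rfl] at h₂
  simp only [Finset.sum_const, card_hyperplanes, hq, nsmul_eq_mul, mul_one, one_mul] at h₀
  obtain ⟨H, hH, hHa⟩ := hK.2.1
  have hle := sub_mul_ncard_le (by omega) (K := K) (c := c) (fun W hW => by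
    rcases hK.1 W (mem_hyperplanes.1 hW) with h | h | h <;> omega) hH
  rw [hHa, hq, haZ, hcZ, show j + 4 - 1 = j + 3 from rfl, show j + 4 - 2 = j + 2 from rfl] at hle
  have hak : (theta q (j + 2) : ℤ) ≤ K.ncard := by
    rw [← haZ, ← hHa]
    exact_mod_cast Set.ncard_le_ncard Set.inter_subset_left (Set.toFinite K)
  have hcop : IsCoprime Q ((s : ℤ) ^ 2 - 1) := by
    rw [hQ]
    exact IsCoprime.pow_left ⟨1, -1, by ring⟩
  obtain ⟨m, hk, hm, hm'⟩ := exists_eq_add_mul hsZ hQ0 hcop hr hN₂ hN₁ hN₀ h₀.symm h₁.symm hak hle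
  obtain ⟨rfl, hta, htc⟩ := multiplicities_eq hsZ hQ4 hr hN₂ hN₁ hN₀ (by positivity)
    (by positivity) (by positivity) h₀.symm h₁.symm (by linear_combination -h₂) hk hm hm'
  have h2 : theta q 2 = s ^ 4 + s ^ 2 + 1 := by
    zify
    exact mul_left_cancel₀ hD.ne' (by rw [hθ]; ring)
  have hs32 : s ^ 3 ≤ q ^ 2 := by
    rw [hqs, ← pow_mul]; exact Nat.pow_le_pow_right (by omega) (by omega)
  refine ⟨?_, ?_, ?_, ?_⟩
  · zify
    rw [hk, haZ, hQ]
    ring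
  · exact_mod_cast hta
  · have : theta q (j + 4) = theta q 2 + tnum F (j + 4) K b := by
      rw [h2]; zify; linarith
    omega
  · zify [hs32]
    rw [htc, hqs]
    push_cast
    ring
end
end

section
/- In PG(n,q), with n ≥ 4 and q a square prime power, let K be an (n−1)-blocking set of type (a,b,c)_{n-1} with a = θ_{n-2}, b = θ_{n-3} + (√q)^{2n−3} and c = θ_{n-2} + (√q)^{2n−3}, and suppose k = θ_{n-2} + (√q)^{2n−1}. Let S = { K ∩ π : π a hyperplane with |K ∩ π| = a }. Then |S| = (√q)³ + 1, every element of S is an (n−2)-dimensional subspace, and any two distinct elements α₁, α₂ of S intersect in an (n−3)-dimensional subspace. -/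
open Module Set

noncomputable section

variable (F : Type) [Field F]

section Counting

open Finset

variable {𝕜 V : Type*} [Field 𝕜] [AddCommGroup V] [Module 𝕜 V] [Finite 𝕜] [FiniteDimensional 𝕜 V]

omit [FiniteDimensional 𝕜 V] in
theorem ncard_finrank_one_le (M : Submodule 𝕜 V) :
    {L : Submodule 𝕜 V | finrank 𝕜 L = 1 ∧ L ≤ M}.ncard =
      ∑ i ∈ range (finrank 𝕜 M), Nat.card 𝕜 ^ i := by
  rw [← Projectivization.card_of_finrank 𝕜 M rfl, ← Set.ncard_univ,
    ← Set.ncard_image_of_injective Set.univ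
      ((Submodule.map_injective_of_injective M.injective_subtype).comp
        (Projectivization.submodule_injective (K := 𝕜) (V := M)))]
  congr 1
  ext L
  simp only [Set.mem_ofPred_eq, Set.image_univ, Set.mem_range, Function.comp_apply]
  constructor
  · rintro ⟨h1, h2⟩
    refine ⟨Projectivization.mk'' (L.comap M.subtype) ?_, ?_⟩
    · rw [← h1]
      exact (Submodule.comapSubtypeEquivOfLe h2).finrank_eq
    · rw [Projectivization.submodule_mk'', Submodule.map_comap_subtype, inf_eq_right.2 h2]
  · rintro ⟨x, rfl⟩
    refine ⟨?_, Submodule.map_subtype_le _ _⟩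
    rw [Submodule.finrank_map_subtype_eq, x.finrank_submodule]

omit [FiniteDimensional 𝕜 V] in
theorem ncard_points_le (M : Submodule 𝕜 V) :
    {x : Projectivization 𝕜 V | x.submodule ≤ M}.ncard =
      ∑ i ∈ range (finrank 𝕜 M), Nat.card 𝕜 ^ i := by
  rw [← ncard_finrank_one_le, ← Set.ncard_image_of_injective _
    (Projectivization.submodule_injective (K := 𝕜) (V := V))]
  congr 1
  ext L
  constructor
  · rintro ⟨x, hx, rfl⟩
    exact ⟨x.finrank_submodule, hx⟩
  · rintro ⟨h1, h2⟩
    exact ⟨Projectivization.mk'' L h1, by simpa using h2, by simp⟩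

/-- The hyperplanes of `V` containing the subspace `U`. -/
def hyperplanesThrough (U : Submodule 𝕜 V) : Finset (Submodule 𝕜 V) :=
  haveI : Finite V := Module.finite_of_finite 𝕜
  (Set.toFinite {W : Submodule 𝕜 V | finrank 𝕜 W + 1 = finrank 𝕜 V ∧ U ≤ W}).toFinset

theorem mem_hyperplanesThrough {U W : Submodule 𝕜 V} :
    W ∈ hyperplanesThrough U ↔ finrank 𝕜 W + 1 = finrank 𝕜 V ∧ U ≤ W := by
  simp [hyperplanesThrough]

theorem card_hyperplanesThrough (U : Submodule 𝕜 V) :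
    #(hyperplanesThrough U) = ∑ i ∈ range (finrank 𝕜 V - finrank 𝕜 U), Nat.card 𝕜 ^ i := by
  have hU := Subspace.finrank_add_finrank_dualAnnihilator_eq U
  rw [← Nat.eq_sub_of_add_eq' hU, ← ncard_finrank_one_le, ← Set.ncard_coe_finset,
    ← Set.ncard_image_of_injective _
      (fun W W' : Submodule 𝕜 V => Subspace.dualAnnihilator_inj.1)]
  congr 1
  ext L
  simp only [Set.mem_image, Finset.mem_coe, mem_hyperplanesThrough, Set.mem_ofPred_eq]
  constructor
  · rintro ⟨W, ⟨h1, h2⟩, rfl⟩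
    have := Subspace.finrank_add_finrank_dualAnnihilator_eq W
    exact ⟨by omega, Submodule.dualAnnihilator_anti h2⟩
  · rintro ⟨h1, h2⟩
    have hL := Subspace.dualCoannihilator_dualAnnihilator_eq (W := L)
    have := Subspace.finrank_add_finrank_dualCoannihilator_eq L
    refine ⟨L.dualCoannihilator, ⟨by omega, ?_⟩, hL⟩
    rwa [← Subspace.dualAnnihilator_le_dualAnnihilator_iff, hL]

omit [Finite 𝕜] in
theorem finrank_sup_submodule {x : Projectivization 𝕜 V} {U : Submodule 𝕜 V}
    (h : ¬ x.submodule ≤ U) : finrank 𝕜 ↥(U ⊔ x.submodule) = finrank 𝕜 U + 1 := by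
  have h1 := Submodule.finrank_sup_add_finrank_inf_eq U x.submodule
  have h2 : U ⊓ x.submodule ≠ x.submodule := fun h' => h (inf_eq_right.1 h')
  have h3 := Submodule.finrank_lt_finrank_of_lt (lt_of_le_of_ne inf_le_right h2)
  rw [x.finrank_submodule] at h1 h3
  omega

open Classical in
/-- Double counting of the pairs (point, hyperplane) with the hyperplane through `U`. -/
theorem sum_card_filter_hyperplanesThrough (U : Submodule 𝕜 V)
    (B : Finset (Projectivization 𝕜 V)) (hB : ∀ x ∈ B, ¬ x.submodule ≤ U) :
    ∑ W ∈ hyperplanesThrough U, #{x ∈ B | x.submodule ≤ W} =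
      #B * ∑ i ∈ range (finrank 𝕜 V - (finrank 𝕜 U + 1)), Nat.card 𝕜 ^ i := by
  refine (Finset.sum_card_bipartiteAbove_eq_sum_card_bipartiteBelow
    fun (W : Submodule 𝕜 V) (x : Projectivization 𝕜 V) => x.submodule ≤ W).trans ?_
  rw [← smul_eq_mul, ← Finset.sum_const]
  refine Finset.sum_congr rfl fun x hx => ?_
  rw [← finrank_sup_submodule (hB x hx), ← card_hyperplanesThrough]
  congr 1
  ext W
  simp [Finset.mem_bipartiteBelow, mem_hyperplanesThrough, and_assoc]

open Classical in
theorem sum_card_filter_sq (B : Finset (Projectivization 𝕜 V)) :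
    ∑ W ∈ hyperplanesThrough (⊥ : Submodule 𝕜 V), #{x ∈ B | x.submodule ≤ W} ^ 2 =
      #B * ∑ i ∈ range (finrank 𝕜 V - 1), Nat.card 𝕜 ^ i +
      #B * (#B - 1) * ∑ i ∈ range (finrank 𝕜 V - 2), Nat.card 𝕜 ^ i := by
  have h1 : ∀ W : Submodule 𝕜 V, #{x ∈ B | x.submodule ≤ W} ^ 2 =
      #{z ∈ B ×ˢ B | z.1.submodule ⊔ z.2.submodule ≤ W} := by
    intro W
    rw [sq, ← Finset.card_product, ← Finset.filter_product]
    simp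
  have h2 : ∀ z : Projectivization 𝕜 V × Projectivization 𝕜 V,
      #{W ∈ hyperplanesThrough (⊥ : Submodule 𝕜 V) | z.1.submodule ⊔ z.2.submodule ≤ W} =
      ∑ i ∈ range (finrank 𝕜 V - if z.1 = z.2 then 1 else 2), Nat.card 𝕜 ^ i := by
    rintro ⟨x, y⟩
    have : finrank 𝕜 ↥(x.submodule ⊔ y.submodule) = if x = y then 1 else 2 := by
      split_ifs with h
      · rw [h, sup_idem, y.finrank_submodule]
      · rw [finrank_sup_submodule, x.finrank_submodule]
        intro h'
        exact h (Projectivization.submodule_injective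
          (Submodule.eq_of_le_of_finrank_eq h' (by simp [Projectivization.finrank_submodule]))).symm
    simp only
    rw [← this, ← card_hyperplanesThrough]
    congr 1
    ext W
    simp [mem_hyperplanesThrough]
  simp_rw [h1]
  refine (Finset.sum_card_bipartiteAbove_eq_sum_card_bipartiteBelow
    fun (W : Submodule 𝕜 V) (z : Projectivization 𝕜 V × Projectivization 𝕜 V) =>
      z.1.submodule ⊔ z.2.submodule ≤ W).trans ?_
  simp_rw [Finset.bipartiteBelow, h2]
  rw [← B.diag_union_offDiag, Finset.sum_union B.disjoint_diag_offDiag,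
    Finset.sum_congr (s₁ := B.diag) rfl
      (g := fun _ => ∑ i ∈ range (finrank 𝕜 V - 1), Nat.card 𝕜 ^ i),
    Finset.sum_congr (s₁ := B.offDiag) rfl
      (g := fun _ => ∑ i ∈ range (finrank 𝕜 V - 2), Nat.card 𝕜 ^ i)]
  · simp [Finset.offDiag_card, Nat.mul_sub]
  · intro z hz
    rw [if_neg (Finset.mem_offDiag.1 hz).2.2]
  · intro z hz
    rw [if_pos (Finset.mem_diag.1 hz).2]

omit [Finite 𝕜] in
theorem finrank_map_mkQ_add {S W : Submodule 𝕜 V} (h : S ≤ W) :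
    finrank 𝕜 ↥(W.map S.mkQ) + finrank 𝕜 S = finrank 𝕜 W := by
  rw [← (S.mkQ.domRestrict W).finrank_range_add_finrank_ker, LinearMap.range_domRestrict,
    LinearMap.ker_domRestrict, Submodule.ker_mkQ]
  congr 1
  exact (Submodule.comapSubtypeEquivOfLe h).finrank_eq.symm

omit [Finite 𝕜] in
theorem finrank_map_submodule_mkQ {x y : Projectivization 𝕜 V} (h : y ≠ x) :
    finrank 𝕜 ↥(y.submodule.map x.submodule.mkQ) = 1 := by
  have h1 : ¬ x.submodule ≤ y.submodule := fun h' => h (Projectivization.submodule_injective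
    (Submodule.eq_of_le_of_finrank_eq h' (by simp [Projectivization.finrank_submodule]))).symm
  have h2 := finrank_map_mkQ_add (le_sup_right : x.submodule ≤ y.submodule ⊔ x.submodule)
  rw [finrank_sup_submodule h1, x.finrank_submodule, y.finrank_submodule, Submodule.map_sup,
    Submodule.mkQ_map_self, sup_bot_eq] at h2
  omega

/-- The Bose–Burton theorem for line blocking sets: a set of points of the subspace `W` that
meets every line of `W` and has as many points as a hyperplane of `W` is a hyperplane of `W`. -/
theorem exists_eq_points_of_blocks {W : Submodule 𝕜 V} {d : ℕ} (hW : finrank 𝕜 W = d + 1)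
    {A : Set (Projectivization 𝕜 V)} (hAW : ∀ x ∈ A, x.submodule ≤ W)
    (hA : A.ncard = ∑ i ∈ range d, Nat.card 𝕜 ^ i)
    (hblock : ∀ L : Submodule 𝕜 V, finrank 𝕜 L = 2 → L ≤ W → ∃ x ∈ A, x.submodule ≤ L) :
    ∃ M : Submodule 𝕜 V, finrank 𝕜 M = d ∧ A = {x | x.submodule ≤ M} := by
  have : Finite V := Module.finite_of_finite 𝕜
  have key : ∀ x : Projectivization 𝕜 V, x.submodule ≤ W → x ∉ A →
      Set.InjOn (fun y : Projectivization 𝕜 V => y.submodule.map x.submodule.mkQ) A := by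
    intro x hx hxA
    refine Set.injOn_of_ncard_image_eq ?_ (Set.toFinite _)
    have hfin : finrank 𝕜 ↥(W.map x.submodule.mkQ) = d := by
      have := finrank_map_mkQ_add hx
      rw [x.finrank_submodule] at this
      omega
    rw [hA, ← hfin, ← ncard_finrank_one_le]
    congr 1
    ext L
    constructor
    · rintro ⟨y, hy, rfl⟩
      exact ⟨finrank_map_submodule_mkQ fun h => hxA (h ▸ hy), Submodule.map_mono (hAW y hy)⟩
    · rintro ⟨h1, h2⟩
      have hL := Submodule.map_comap_eq_of_surjective x.submodule.mkQ_surjective L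
      have hxL : x.submodule ≤ L.comap x.submodule.mkQ := by
        conv_lhs => rw [← Submodule.ker_mkQ x.submodule]
        exact Submodule.comap_mono bot_le
      have h3 := finrank_map_mkQ_add hxL
      rw [hL, h1, x.finrank_submodule] at h3
      obtain ⟨y, hy, hyL⟩ := hblock _ h3.symm <| by
        refine (Submodule.comap_mono h2).trans ?_
        rw [Submodule.comap_map_mkQ, sup_eq_right.2 hx]
      refine ⟨y, hy, Submodule.eq_of_le_of_finrank_eq (Submodule.map_le_iff_le_comap.2 hyL) ?_⟩
      rw [h1, finrank_map_submodule_mkQ (by rintro rfl; exact hxA hy)]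
  let M : Submodule 𝕜 V :=
    { carrier := {v | ∀ h : v ≠ 0, Projectivization.mk 𝕜 v h ∈ A}
      zero_mem' := fun h => (h rfl).elim
      smul_mem' := by
        intro c v hv h
        have hv0 : v ≠ 0 := by rintro rfl; simp at h
        convert hv hv0 using 1
        rw [Projectivization.mk_eq_mk_iff']
        exact ⟨c, rfl⟩
      add_mem' := by
        intro v w hv hw h
        rcases eq_or_ne v 0 with rfl | hv0
        · simpa using hw (by simpa using h)
        rcases eq_or_ne w 0 with rfl | hw0
        · simpa using hv hv0
        by_contra hA'
        have hvW := hAW _ (hv hv0)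
        have hwW := hAW _ (hw hw0)
        rw [Projectivization.submodule_mk, Submodule.span_singleton_le_iff_mem] at hvW hwW
        have hvw : Projectivization.mk 𝕜 v hv0 = Projectivization.mk 𝕜 w hw0 := by
          refine key (Projectivization.mk 𝕜 (v + w) h) ?_ hA' (hv hv0) (hw hw0) ?_
          · rw [Projectivization.submodule_mk, Submodule.span_singleton_le_iff_mem]
            exact W.add_mem hvW hwW
          · have h0 : (Submodule.span 𝕜 {v + w}).mkQ v = -(Submodule.span 𝕜 {v + w}).mkQ w := by
              rw [eq_neg_iff_add_eq_zero, ← map_add, Submodule.mkQ_apply,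
                Submodule.Quotient.mk_eq_zero]
              exact Submodule.mem_span_singleton_self _
            simp only [Projectivization.submodule_mk, Submodule.map_span, Set.image_singleton]
            rw [h0, ← Set.neg_singleton, Submodule.span_neg]
        obtain ⟨a, ha⟩ := (Projectivization.mk_eq_mk_iff' 𝕜 _ _ _ _).1 hvw
        apply hA'
        convert hw hw0 using 1
        rw [Projectivization.mk_eq_mk_iff']
        exact ⟨a + 1, by rw [add_smul, ha, one_smul]⟩ }
  have hAM : A = {x | x.submodule ≤ M} := by
    ext x
    induction x using Projectivization.ind with | h v hv =>
    rw [Set.mem_ofPred_eq, Projectivization.submodule_mk, Submodule.span_singleton_le_iff_mem]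
    exact ⟨fun h _ => h, fun h => h hv⟩
  refine ⟨M, ?_, hAM⟩
  rw [hAM, ncard_points_le] at hA
  have hmono : StrictMono fun m => ∑ i ∈ range m, Nat.card 𝕜 ^ i :=
    strictMono_nat_of_lt_succ fun m => by
      have := pow_pos (Nat.card_pos (α := 𝕜)) m
      simp [Finset.sum_range_succ]
  exact hmono.injective hA

/-- The number of hyperplanes meeting a set of `k` points in `r + Q` points is determined by the
moments of the intersection numbers. Over the field with `s ^ 2` elements, `r` is the number of
points of a projective space and `Q` the number of points added by raising its dimension by one. -/
theorem card_filter_of_moments {ι : Type*} (H : Finset ι) (f : ι → ℕ) {s r Q k : ℕ} (hs : 2 ≤ s)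
    (hQ : Q + r = s ^ 2 * r + 1) (hk : k = r + Q + s ^ 3 * Q)
    (h0 : #H = r + Q + s ^ 2 * Q + s ^ 4 * Q)
    (h1 : ∑ W ∈ H, f W = k * (r + Q + s ^ 2 * Q))
    (h2 : ∑ W ∈ H, f W ^ 2 = k * (r + Q + s ^ 2 * Q) + k * (k - 1) * (r + Q))
    (hf : ∀ W ∈ H, f W = r + Q ∨ f W = r + s * Q ∨ f W = r + Q + s * Q) :
    #{W ∈ H | f W = r + Q} = s ^ 3 + 1 := by
  have hQpos : 0 < Q := by
    have : r ≤ s ^ 2 * r := Nat.le_mul_of_pos_left _ (by positivity)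
    omega
  have hk1 : 1 ≤ k := by omega
  have hsum : ∑ W ∈ H, ((f W : ℤ) - (r + s * Q)) * (f W - (r + Q + s * Q)) =
      #{W ∈ H | f W = r + Q} * (Q ^ 2 * s * (s - 1) : ℤ) := by
    rw [← nsmul_eq_mul (_ : ℕ) (_ * _ * _ : ℤ), ← Finset.sum_const, Finset.sum_filter]
    refine Finset.sum_congr rfl fun W hW => ?_
    split_ifs with h
    · rw [h]; push_cast; ring
    · rcases hf W hW with h' | h' | h'
      · exact (h h').elim
      · rw [h']; push_cast; ring
      · rw [h']; push_cast; ring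
  have hexp : ∑ W ∈ H, ((f W : ℤ) - (r + s * Q)) * (f W - (r + Q + s * Q)) =
      ((∑ W ∈ H, f W ^ 2 : ℕ) : ℤ) - (2 * r + Q + 2 * s * Q) * ((∑ W ∈ H, f W : ℕ) : ℤ) +
        #H * ((r + s * Q) * (r + Q + s * Q)) := by
    push_cast
    rw [Finset.mul_sum, ← nsmul_eq_mul #H, ← Finset.sum_const, ← Finset.sum_sub_distrib,
      ← Finset.sum_add_distrib]
    exact Finset.sum_congr rfl fun W _ => by ring
  rw [hsum, h0, h1, h2] at hexp
  push_cast [Nat.cast_sub hk1] at hexp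
  have hQ' : (Q : ℤ) = s ^ 2 * r + 1 - r := by
    have : (Q : ℤ) + r = s ^ 2 * r + 1 := by exact_mod_cast hQ
    linarith
  have hne : (Q ^ 2 * s * (s - 1) : ℤ) ≠ 0 := by
    have : (2 : ℤ) ≤ s := by exact_mod_cast hs
    have : (0 : ℤ) < Q := by exact_mod_cast hQpos
    have : (0 : ℤ) < s - 1 := by linarith
    positivity
  have : (#{W ∈ H | f W = r + Q} : ℤ) = s ^ 3 + 1 := by
    apply mul_right_cancel₀ hne
    rw [hexp, hk]
    push_cast
    rw [hQ']
    ring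
  exact_mod_cast this

omit [Finite 𝕜] [FiniteDimensional 𝕜 V] in
theorem points_subset_points_iff {M W : Submodule 𝕜 V} :
    {x : Projectivization 𝕜 V | x.submodule ≤ M} ⊆ {x | x.submodule ≤ W} ↔ M ≤ W := by
  refine ⟨fun h v hv => ?_, fun h x hx => le_trans hx h⟩
  rcases eq_or_ne v 0 with rfl | hv0
  · exact W.zero_mem
  have := @h (Projectivization.mk 𝕜 v hv0)
  simp only [Set.mem_ofPred_eq, Projectivization.submodule_mk,
    Submodule.span_singleton_le_iff_mem] at this
  exact this hv

theorem theta_eq_sum {q : ℕ} (hq : 2 ≤ q) (m : ℕ) :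
    theta q m = ∑ i ∈ range (m + 1), q ^ i :=
  (Nat.geomSum_eq hq (m + 1)).symm

open Classical in
/-- A codimension two subspace contained in a point set lies in at most one hyperplane containing
no further point of the set, provided that the other hyperplanes contain few points. -/
theorem eq_of_filter_subset_codim_two {n c : ℕ} (hV : finrank 𝕜 V = n + 1) {M : Submodule 𝕜 V}
    (hM : finrank 𝕜 M + 1 = n) (B : Finset (Projectivization 𝕜 V))
    (hBM : ∀ x ∈ B, ¬ x.submodule ≤ M)
    (hc : ∀ W ∈ hyperplanesThrough M, #{x ∈ B | x.submodule ≤ W} ≤ c)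
    (hB : (Nat.card 𝕜 - 1) * c < #B) {W₁ W₂ : Submodule 𝕜 V}
    (hW₁ : W₁ ∈ hyperplanesThrough M) (hW₂ : W₂ ∈ hyperplanesThrough M)
    (h₁ : #{x ∈ B | x.submodule ≤ W₁} = 0) (h₂ : #{x ∈ B | x.submodule ≤ W₂} = 0) :
    W₁ = W₂ := by
  by_contra hne
  have hsum := sum_card_filter_hyperplanesThrough M B hBM
  have hcard := card_hyperplanesThrough M
  rw [show finrank 𝕜 V - (finrank 𝕜 M + 1) = 1 by omega] at hsum
  rw [show finrank 𝕜 V - finrank 𝕜 M = 2 by omega] at hcard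
  simp only [Finset.sum_range_succ, Finset.range_zero, Finset.sum_empty, pow_zero, pow_one,
    zero_add, mul_one] at hsum hcard
  have hsub : ({W₁, W₂} : Finset (Submodule 𝕜 V)) ⊆ hyperplanesThrough M := by
    simp [Finset.insert_subset_iff, hW₁, hW₂]
  rw [← Finset.sum_sdiff hsub, Finset.sum_pair hne, h₁, h₂, add_zero, add_zero] at hsum
  have hle := Finset.sum_le_card_nsmul (hyperplanesThrough M \ {W₁, W₂}) _ c
    fun W hW => hc W (Finset.mem_sdiff.1 hW).1
  rw [hsum, Finset.card_sdiff_of_subset hsub, Finset.card_pair hne, hcard, smul_eq_mul,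
    show 1 + Nat.card 𝕜 - 2 = Nat.card 𝕜 - 1 by omega] at hle
  omega

end Counting

/-- In the situation of the unital-cone theorem with
`k = θ_{n-2} + √q^{2n-1}`, the family `S = {K ∩ π : π a hyperplane with |K ∩ π| = a}`
has `√q³ + 1` members, each member is (the point set of) an `(n-2)`-dimensional
subspace, and any two distinct members meet in (the point set of) an
`(n-3)`-dimensional subspace. -/
theorem statement17 [Fintype F] (p e q sq n : ℕ) (hp : p.Prime) (he : 0 < e)
    (hqdef : q = p ^ (2 * e)) (hsq : sq = p ^ e) (hq : Fintype.card F = q)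
    (hn : 4 ≤ n)
    (K : Set (PGPoint F n)) (hblock : BlocksDim F n 1 K)
    (hK : IsType3 F n K (theta q (n - 2)) (theta q (n - 3) + sq ^ (2 * n - 3))
      (theta q (n - 2) + sq ^ (2 * n - 3)))
    (hk : K.ncard = theta q (n - 2) + sq ^ (2 * n - 1))
    (S : Set (Set (PGPoint F n)))
    (hS : S = {A | ∃ W : Submodule F (Fin (n + 1) → F), finrank F W = n ∧
      (K ∩ projSet F n W).ncard = theta q (n - 2) ∧ A = K ∩ projSet F n W}) :
    S.ncard = sq ^ 3 + 1 ∧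
    (∀ A ∈ S, ∃ Wα : Submodule F (Fin (n + 1) → F),
      finrank F Wα = n - 1 ∧ A = projSet F n Wα) ∧
    (∀ A₁ ∈ S, ∀ A₂ ∈ S, A₁ ≠ A₂ →
      ∃ Wβ : Submodule F (Fin (n + 1) → F),
        finrank F Wβ = n - 2 ∧ A₁ ∩ A₂ = projSet F n Wβ) := by
  classical
  obtain ⟨m, rfl⟩ : ∃ m, n = m + 2 := ⟨n - 2, by omega⟩
  have hs : 2 ≤ sq := hsq ▸ hp.two_le.trans (Nat.le_self_pow he.ne' p)
  have hqs : q = sq ^ 2 := by rw [hqdef, hsq, ← pow_mul, mul_comm]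
  have hq2 : 2 ≤ q := by nlinarith
  have hcardF : Nat.card F = q := by rw [Nat.card_eq_fintype_card, hq]
  have hV : finrank F (Fin (m + 2 + 1) → F) = m + 3 := Module.finrank_fin_fun F
  set r := ∑ i ∈ Finset.range m, q ^ i with hr
  set Q := q ^ m with hQdef
  have hsQ : ∀ j, sq ^ (2 * m + j) = sq ^ j * Q := fun j => by
    rw [hQdef, hqs, ← pow_mul, ← pow_add, add_comm]
  have hQ : Q + r = sq ^ 2 * r + 1 := by
    rw [← hqs, hr, hQdef, add_comm, ← Finset.sum_range_succ, Finset.sum_range_succ',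
      Finset.mul_sum]
    simp [pow_succ']
  have hr1 : ∑ i ∈ Finset.range (m + 1), q ^ i = r + Q := Finset.sum_range_succ _ _
  have hr2 : ∑ i ∈ Finset.range (m + 2), q ^ i = r + Q + sq ^ 2 * Q := by
    rw [Finset.sum_range_succ, hr1, pow_succ', ← hqs]
  have hr3 : ∑ i ∈ Finset.range (m + 3), q ^ i = r + Q + sq ^ 2 * Q + sq ^ 4 * Q := by
    rw [Finset.sum_range_succ, hr2, pow_add, ← hQdef, hqs]
    ring
  rw [theta_eq_sum hq2, theta_eq_sum hq2, show m + 2 - 3 + 1 = m by omega,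
    show 2 * (m + 2) - 3 = 2 * m + 1 by omega, show m + 2 - 2 + 1 = m + 1 by omega, hr1, hsQ,
    pow_one, ← hr] at hK
  rw [theta_eq_sum hq2, show 2 * (m + 2) - 1 = 2 * m + 3 by omega,
    show m + 2 - 2 + 1 = m + 1 by omega, hr1, hsQ] at hk
  rw [theta_eq_sum hq2, show m + 2 - 2 + 1 = m + 1 by omega, hr1] at hS
  set B : Finset (Projectivization F (Fin (m + 2 + 1) → F)) := (Set.toFinite K).toFinset
    with hBdef
  have hcard : ∀ W, (K ∩ projSet F (m + 2) W).ncard = Finset.card {x ∈ B | x.submodule ≤ W} := by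
    intro W
    rw [← Set.ncard_coe_finset]
    congr 1
    ext x
    simp [hBdef, projSet]
  have hBcard : B.card = r + Q + sq ^ 3 * Q := by
    rw [← hk, ← Set.ncard_eq_toFinset_card K]
  have hmem : ∀ {U W : Submodule F (Fin (m + 2 + 1) → F)},
      W ∈ hyperplanesThrough U ↔ finrank F W = m + 2 ∧ U ≤ W := by
    intro U W
    rw [mem_hyperplanesThrough, hV]
    simp
  have hcount : Finset.card {W ∈ hyperplanesThrough (⊥ : Submodule F (Fin (m + 2 + 1) → F)) |
      Finset.card {x ∈ B | x.submodule ≤ W} = r + Q} = sq ^ 3 + 1 := by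
    refine card_filter_of_moments _ _ hs hQ hBcard ?_ ?_ ?_ ?_
    · rw [card_hyperplanesThrough, hV, finrank_bot, hcardF, Nat.sub_zero, hr3]
    · rw [sum_card_filter_hyperplanesThrough, hV, finrank_bot, hcardF]
      · exact congrArg _ hr2
      · intro x _ h
        have := x.finrank_submodule
        rw [le_bot_iff.1 h, finrank_bot] at this
        omega
    · rw [sum_card_filter_sq, hV, hcardF, show m + 3 - 1 = m + 2 by omega,
        show m + 3 - 2 = m + 1 by omega, hr1, hr2]
    · intro W hW
      rw [← hcard]
      exact hK.1 W (hmem.1 hW).1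
  have hsub : ∀ W : Submodule F (Fin (m + 2 + 1) → F), finrank F W = m + 2 →
      (K ∩ projSet F (m + 2) W).ncard = r + Q →
      ∃ M : Submodule F (Fin (m + 2 + 1) → F), finrank F M = m + 1 ∧
        K ∩ projSet F (m + 2) W = projSet F (m + 2) M := by
    intro W hW ha
    refine exists_eq_points_of_blocks hW (fun x hx => hx.2) ?_ fun L hL hLW => ?_
    · rw [ha, hcardF, hr1]
    · obtain ⟨x, hxK, hxL⟩ := hblock L hL
      exact ⟨x, ⟨hxK, le_trans hxL hLW⟩, hxL⟩
  have hinj : ∀ W₁ W₂ : Submodule F (Fin (m + 2 + 1) → F), finrank F W₁ = m + 2 →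
      finrank F W₂ = m + 2 → (K ∩ projSet F (m + 2) W₁).ncard = r + Q →
      K ∩ projSet F (m + 2) W₁ = K ∩ projSet F (m + 2) W₂ → W₁ = W₂ := by
    intro W₁ W₂ hW₁ hW₂ ha heq
    obtain ⟨M, hM, hKM⟩ := hsub W₁ hW₁ ha
    have hle : ∀ W, K ∩ projSet F (m + 2) W = projSet F (m + 2) M → M ≤ W := fun W h =>
      points_subset_points_iff.1 (h.symm.subset.trans Set.inter_subset_right)
    have hMK : ∀ x : Projectivization F (Fin (m + 2 + 1) → F), x.submodule ≤ M → x ∈ B := fun x hx => by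
      have : x ∈ K ∩ projSet F (m + 2) W₁ := hKM ▸ hx
      simpa [hBdef] using this.1
    have hMcard : Finset.card {x ∈ B | x.submodule ≤ M} = r + Q := by
      rw [← hcard, ← ha, hKM, Set.inter_eq_right.2]
      exact fun x hx => by simpa [hBdef] using hMK x hx
    have hsplit : ∀ W, M ≤ W →
        Finset.card {x ∈ {x ∈ B | ¬ x.submodule ≤ M} | x.submodule ≤ W} + (r + Q) =
          (K ∩ projSet F (m + 2) W).ncard := by
      intro W hMW
      rw [hcard, ← hMcard, ← Finset.card_filter_add_card_filter_not
        (s := {x ∈ B | x.submodule ≤ W}) (fun x => x.submodule ≤ M), add_comm,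
        Finset.filter_filter, Finset.filter_filter, Finset.filter_filter]
      congr 2
      · exact Finset.filter_congr fun x _ => ⟨fun h => ⟨h.trans hMW, h⟩, fun h => h.2⟩
      · exact Finset.filter_congr fun x _ => and_comm
    have hB := Finset.card_filter_add_card_filter_not (s := B) (fun x => x.submodule ≤ M)
    have hQpos : 0 < Q := pow_pos (by omega) _
    refine eq_of_filter_subset_codim_two (c := sq * Q) hV (by omega) {x ∈ B | ¬ x.submodule ≤ M}
      (fun x hx => (Finset.mem_filter.1 hx).2) (fun W hW => ?_) ?_
      (hmem.2 ⟨hW₁, hle W₁ hKM⟩) (hmem.2 ⟨hW₂, hle W₂ (heq ▸ hKM)⟩) ?_ ?_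
    · have h1 := hsplit W (hmem.1 hW).2
      have h2 := hK.1 W (hmem.1 hW).1
      have h3 : Q ≤ sq * Q := Nat.le_mul_of_pos_left _ (by omega)
      omega
    · have h1 : Finset.card {x ∈ B | ¬ x.submodule ≤ M} = q * (sq * Q) := by
        rw [hqs, show sq ^ 2 * (sq * Q) = sq ^ 3 * Q by ring]
        omega
      rw [h1, hcardF]
      exact Nat.mul_lt_mul_of_pos_right (by omega) (by positivity)
    · have := hsplit W₁ (hle W₁ hKM)
      omega
    · have := hsplit W₂ (hle W₂ (heq ▸ hKM))
      rw [← heq] at this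
      omega
  subst hS
  refine ⟨?_, ?_, ?_⟩
  · rw [← hcount, ← Set.ncard_coe_finset, ← Set.InjOn.ncard_image
      (f := fun W => K ∩ projSet F (m + 2) W)]
    · congr 1
      ext A
      simp only [Set.mem_ofPred_eq, Set.mem_image, Finset.mem_coe, Finset.mem_filter, hmem,
        ← hcard, bot_le, and_true, and_assoc, eq_comm (a := A)]
    · intro W₁ h₁ W₂ h₂ h
      simp only [Finset.mem_coe, Finset.mem_filter, hmem, ← hcard] at h₁ h₂
      exact hinj W₁ W₂ h₁.1.1 h₂.1.1 h₁.2 h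
  · rintro A ⟨W, hW, ha, rfl⟩
    exact hsub W hW ha
  · rintro A₁ ⟨W₁, hW₁, ha₁, rfl⟩ A₂ ⟨W₂, hW₂, ha₂, rfl⟩ hne
    obtain ⟨M, hM, hKM⟩ := hsub W₁ hW₁ ha₁
    refine ⟨M ⊓ W₂, ?_, ?_⟩
    · have hMW : ¬ M ≤ W₂ := by
        intro h
        refine hne (Set.eq_of_subset_of_ncard_le (fun x hx => ⟨hx.1, ?_⟩) (by omega)
          (Set.toFinite _))
        rw [hKM] at hx
        exact le_trans hx h
      have h1 := Submodule.finrank_sup_add_finrank_inf_eq M W₂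
      have h2 := Submodule.finrank_lt_finrank_of_lt
        (lt_of_le_of_ne (le_sup_right : W₂ ≤ M ⊔ W₂) fun h => hMW (h ▸ le_sup_left))
      have h3 := Submodule.finrank_le (M ⊔ W₂)
      omega
    · rw [← Set.inter_inter_distrib_left, ← Set.inter_assoc, hKM]
      ext x
      simp [projSet]
end
end
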